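/- Let 𝐗 = (X,𝕏) be a level-2 α-Hölder rough path over V, let 𝐙 = (Z,Z') be an 𝐗-controlled rough path with values in U, let F ∈ C_b^3(W, L(U,W)), and let y₀ ∈ W. Then there exists τ ∈ (0,T] such that there is exactly one pair (Y,Y') on [0,τ] which is a controlled rough path over the restriction of 𝐗 to [0,τ] with values in W and satisfies: Y_0 = y₀; Y'_t = F(Y_t) ∘ Z'_t for all t ∈ [0,τ]; and Y_t = y₀ + ∫_0^t F(Y_r) dZ_r for all t ∈ [0,τ], where ∫_0^t F(Y_r) dZ_r denotes the rough integral of the controlled rough path (F ∘ Y, s ↦ DF(Y_s) ∘ Y'_s) against 𝐙. -/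

import Mathlib

/-!  Common definitions: level-2 rough paths, controlled rough paths,
compensated Riemann sums and rough integrals of a controlled rough path
against another controlled rough path. -/

open scoped BigOperators

noncomputable section

/-- `HBound T β A` : the two-parameter map `A` satisfies a `β`-Hölder bound on the
simplex `{0 ≤ s < t ≤ T}`. -/
def HBound {E : Type*} [NormedAddCommGroup E] (T β : ℝ) (A : ℝ → ℝ → E) : Prop :=
  ∃ C : ℝ, ∀ s t : ℝ, 0 ≤ s → s < t → t ≤ T → ‖A s t‖ ≤ C * (t - s) ^ β

/-- The Hölder seminorm `‖A‖_β = sup_{0 ≤ s < t ≤ T} ‖A_{s,t}‖ / (t-s)^β`, realised as the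
least admissible Hölder constant. -/
def hnorm {E : Type*} [NormedAddCommGroup E] (T β : ℝ) (A : ℝ → ℝ → E) : ℝ :=
  sInf {C : ℝ | 0 ≤ C ∧ ∀ s t : ℝ, 0 ≤ s → s < t → t ≤ T → ‖A s t‖ ≤ C * (t - s) ^ β}

/-- An abstract model of the projective tensor product `V ⊗̂ V`, bundling the canonical
bounded bilinear map `tmul : V × V → V ⊗̂ V` and the pairing `⋆` sending
`A ∈ L(V, L(W,U))` and `B ∈ L(V,W)` to the induced operator `A ⋆ B ∈ L(V ⊗̂ V, U)`,
characterised by `(A ⋆ B)(v₁ ⊗ v₂) = (A v₁)(B v₂)` and `‖A ⋆ B‖ ≤ ‖A‖ ‖B‖`. -/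
structure TensorOps (V V2 W U : Type*)
    [NormedAddCommGroup V] [NormedSpace ℝ V] [NormedAddCommGroup V2] [NormedSpace ℝ V2]
    [NormedAddCommGroup W] [NormedSpace ℝ W] [NormedAddCommGroup U] [NormedSpace ℝ U] where
  tmul : V →L[ℝ] V →L[ℝ] V2
  tmul_le : ∀ a b : V, ‖tmul a b‖ ≤ ‖a‖ * ‖b‖
  spair : (V →L[ℝ] (W →L[ℝ] U)) →L[ℝ] ((V →L[ℝ] W) →L[ℝ] (V2 →L[ℝ] U))
  spair_tmul : ∀ (A : V →L[ℝ] (W →L[ℝ] U)) (B : V →L[ℝ] W) (a b : V),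
    spair A B (tmul a b) = (A a) (B b)
  spair_le : ∀ (A : V →L[ℝ] (W →L[ℝ] U)) (B : V →L[ℝ] W), ‖spair A B‖ ≤ ‖A‖ * ‖B‖

section Defs

variable {V V2 E : Type*}
  [NormedAddCommGroup V] [NormedSpace ℝ V] [NormedAddCommGroup V2] [NormedSpace ℝ V2]
  [NormedAddCommGroup E] [NormedSpace ℝ E]

/-- `(X, XX)` is a level-2 `α`-Hölder rough path on `[0,T]`:
Chen's relation plus the analytic estimates. -/
structure IsRoughPath (T α : ℝ) (tmul : V →L[ℝ] V →L[ℝ] V2)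
    (X : ℝ → V) (XX : ℝ → ℝ → V2) : Prop where
  chen : ∀ s u t : ℝ, 0 ≤ s → s ≤ u → u ≤ t → t ≤ T →
    XX s t = XX s u + XX u t + tmul (X u - X s) (X t - X u)
  x_hold : HBound T α fun s t => X t - X s
  xx_hold : HBound T (2 * α) XX

/-- `‖𝐗‖_α := ‖X‖_α + ‖𝕏‖_{2α}`. -/
def rpNorm (T α : ℝ) (X : ℝ → V) (XX : ℝ → ℝ → V2) : ℝ :=
  hnorm T α (fun s t => X t - X s) + hnorm T (2 * α) XX

/-- `‖𝐗 − 𝐗̃‖_α := ‖X − X̃‖_α + ‖𝕏 − 𝕏̃‖_{2α}`. -/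
def rpDist (T α : ℝ) (X Xt : ℝ → V) (XX XXt : ℝ → ℝ → V2) : ℝ :=
  hnorm T α (fun s t => (X t - X s) - (Xt t - Xt s)) +
    hnorm T (2 * α) fun s t => XX s t - XXt s t

/-- The remainder `R^{𝐘}_{s,t} := Y_{s,t} − Y'_s(X_{s,t})` of a controlled rough path. -/
def Rem (X : ℝ → V) (Y : ℝ → E) (Y' : ℝ → V →L[ℝ] E) (s t : ℝ) : E :=
  Y t - Y s - Y' s (X t - X s)

/-- `(Y, Y')` is an `𝐗`-controlled rough path on `[0,T]` with values in `E`. -/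
structure IsCRP (T α : ℝ) (X : ℝ → V) (Y : ℝ → E) (Y' : ℝ → V →L[ℝ] E) : Prop where
  deriv_hold : HBound T α fun s t => Y' t - Y' s
  rem_hold : HBound T (2 * α) (Rem X Y Y')

/-- `‖𝐘‖_{𝐗;α} := ‖R^{𝐘}‖_{2α} + ‖Y'‖_α`. -/
def crpNorm (T α : ℝ) (X : ℝ → V) (Y : ℝ → E) (Y' : ℝ → V →L[ℝ] E) : ℝ :=
  hnorm T (2 * α) (Rem X Y Y') + hnorm T α fun s t => Y' t - Y' s

/-- `d_{𝐗,𝐗̃;α}(𝐘,𝐘̃) := ‖R^{𝐘} − R^{𝐘̃}‖_{2α} + ‖Y' − Ỹ'‖_α`. -/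
def crpDist (T α : ℝ) (X Xt : ℝ → V) (Y : ℝ → E) (Y' : ℝ → V →L[ℝ] E)
    (Yt : ℝ → E) (Yt' : ℝ → V →L[ℝ] E) : ℝ :=
  hnorm T (2 * α) (fun s t => Rem X Y Y' s t - Rem Xt Yt Yt' s t) +
    hnorm T α fun s t => (Y' t - Y' s) - (Yt' t - Yt' s)

/-- `p` is a finite partition `s = p 0 < p 1 < ⋯ < p n = t` of `[s,t]`. -/
def IsPartition (s t : ℝ) (n : ℕ) (p : ℕ → ℝ) : Prop :=
  p 0 = s ∧ p n = t ∧ ∀ i < n, p i < p (i + 1)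

end Defs

section Sums

variable {V V2 W U : Type*}
  [NormedAddCommGroup V] [NormedSpace ℝ V] [NormedAddCommGroup V2] [NormedSpace ℝ V2]
  [NormedAddCommGroup W] [NormedSpace ℝ W] [NormedAddCommGroup U] [NormedSpace ℝ U]

/-- The compensated Riemann sum
`∫_P Y dZ := Σ_i [ Y_{t_i}(Z_{t_i,t_{i+1}}) + (Y'_{t_i} ⋆ Z'_{t_i})(𝕏_{t_i,t_{i+1}}) ]`. -/
def rsum (tops : TensorOps V V2 W U) (XX : ℝ → ℝ → V2)
    (Y : ℝ → W →L[ℝ] U) (Y' : ℝ → V →L[ℝ] (W →L[ℝ] U))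
    (Z : ℝ → W) (Z' : ℝ → V →L[ℝ] W) (n : ℕ) (p : ℕ → ℝ) : U :=
  ∑ i ∈ Finset.range n,
    ((Y (p i)) (Z (p (i + 1)) - Z (p i)) +
      (tops.spair (Y' (p i)) (Z' (p i))) (XX (p i) (p (i + 1))))

/-- `I` is the rough integral `∫_s^t Y dZ`: the limit of the compensated Riemann sums
as the mesh of the partition tends to `0`. -/
def IsRoughIntegral (tops : TensorOps V V2 W U) (XX : ℝ → ℝ → V2)
    (Y : ℝ → W →L[ℝ] U) (Y' : ℝ → V →L[ℝ] (W →L[ℝ] U))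
    (Z : ℝ → W) (Z' : ℝ → V →L[ℝ] W) (s t : ℝ) (I : U) : Prop :=
  ∀ ε : ℝ, 0 < ε → ∃ δ : ℝ, 0 < δ ∧ ∀ (n : ℕ) (p : ℕ → ℝ), IsPartition s t n p →
    (∀ i < n, p (i + 1) - p i < δ) → ‖rsum tops XX Y Y' Z Z' n p - I‖ ≤ ε

end Sums

/-- The constant `C_α := (1 + T^α + T^{2α}) · 2^{3α} · Σ_{n≥1} n^{-3α}`. -/
def Calpha (T α : ℝ) : ℝ :=
  (1 + T ^ α + T ^ (2 * α)) * (2 : ℝ) ^ (3 * α) * ∑' n : ℕ, ((n : ℝ) + 1) ^ (-(3 * α))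

/-- `F ∈ C_b^k`: `k` times continuously Fréchet differentiable with all derivatives
up to order `k` bounded. -/
def IsCb {E₁ E₂ : Type*} [NormedAddCommGroup E₁] [NormedSpace ℝ E₁]
    [NormedAddCommGroup E₂] [NormedSpace ℝ E₂] (k : ℕ) (F : E₁ → E₂) : Prop :=
  ContDiff ℝ (k : ℕ∞) F ∧ ∀ j ≤ k, ∃ C : ℝ, ∀ x, ‖iteratedFDeriv ℝ j F x‖ ≤ C

/-- `‖F‖_{C_b^k} := Σ_{j=0}^k sup_x ‖D^j F(x)‖`. -/
def cbNorm {E₁ E₂ : Type*} [NormedAddCommGroup E₁] [NormedSpace ℝ E₁]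
    [NormedAddCommGroup E₂] [NormedSpace ℝ E₂] (k : ℕ) (F : E₁ → E₂) : ℝ :=
  ∑ j ∈ Finset.range (k + 1), ⨆ x : E₁, ‖iteratedFDeriv ℝ j F x‖

end

section Sewing

variable {E : Type*} [NormedAddCommGroup E]

/-- An almost additive two-parameter map which is `O((t - s) ^ θ')` for some `θ' > 1` is bounded
by the defect of its additivity. -/
theorem norm_le_of_almost_additive {A : ℝ → ℝ → E} {a b θ θ' K C : ℝ} (hθ : 1 < θ) (hθ' : 1 < θ')
    (hδ : ∀ s u t, a ≤ s → s ≤ u → u ≤ t → t ≤ b →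
      ‖A s t - A s u - A u t‖ ≤ K * (t - s) ^ θ)
    (hA : ∀ s t, a ≤ s → s ≤ t → t ≤ b → ‖A s t‖ ≤ C * (t - s) ^ θ') :
    ∀ s t, a ≤ s → s ≤ t → t ≤ b → ‖A s t‖ ≤ K / (1 - 2 ^ (1 - θ)) * (t - s) ^ θ := by
  have hr : (2 : ℝ) ^ (1 - θ) < 1 := Real.rpow_lt_one_of_one_lt_of_neg (by norm_num) (by linarith)
  have hr' : (2 : ℝ) ^ (1 - θ') < 1 :=
    Real.rpow_lt_one_of_one_lt_of_neg (by norm_num) (by linarith)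
  have hr'0 : (0 : ℝ) ≤ (2 : ℝ) ^ (1 - θ') := by positivity
  set r := (2 : ℝ) ^ (1 - θ) with hrd
  set r' := (2 : ℝ) ^ (1 - θ') with hrd'
  have half : ∀ (x η : ℝ), 0 ≤ x → 2 * (x / 2) ^ η = 2 ^ (1 - η) * x ^ η := by
    intro x η hx
    rw [Real.div_rpow hx (by norm_num), Real.rpow_sub (by norm_num), Real.rpow_one]
    ring
  have key : ∀ n : ℕ, ∀ s t, a ≤ s → s ≤ t → t ≤ b →
      ‖A s t‖ ≤ K / (1 - r) * (t - s) ^ θ + C * (t - s) ^ θ' * r' ^ n := by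
    intro n
    induction n with
    | zero =>
      intro s t hs hst ht
      have h0 : 0 ≤ K * (t - s) ^ θ := (norm_nonneg _).trans (hδ s s t hs le_rfl hst ht)
      have h1 : 0 ≤ K / (1 - r) * (t - s) ^ θ := by
        rw [div_mul_eq_mul_div]; exact div_nonneg h0 (by linarith)
      have := hA s t hs hst ht
      simp only [pow_zero, mul_one]; linarith
    | succ n ih =>
      intro s t hs hst ht
      obtain ⟨u, hu⟩ : ∃ u, u = (s + t) / 2 := ⟨_, rfl⟩
      have h1 := ih s u hs (by linarith) (by linarith)
      have h2 := ih u t (by linarith) (by linarith) ht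
      have h3 := hδ s u t hs (by linarith) (by linarith) ht
      have e1 : u - s = (t - s) / 2 := by rw [hu]; ring
      have e2 : t - u = (t - s) / 2 := by rw [hu]; ring
      rw [e1] at h1; rw [e2] at h2
      have tri : ‖A s t‖ ≤ ‖A s t - A s u - A u t‖ + ‖A s u‖ + ‖A u t‖ := by
        have : A s t = (A s t - A s u - A u t) + A s u + A u t := by abel
        calc ‖A s t‖ = ‖(A s t - A s u - A u t) + A s u + A u t‖ := by rw [← this]
          _ ≤ _ := norm_add₃_le
      have f1 := half (t - s) θ (by linarith)
      have f2 := half (t - s) θ' (by linarith)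
      rw [← hrd] at f1
      rw [← hrd'] at f2
      have hne : 1 - r ≠ 0 := by linarith
      have : K / (1 - r) * (t - s) ^ θ + C * (t - s) ^ θ' * r' ^ (n + 1)
          = K * (t - s) ^ θ + K / (1 - r) * (r * (t - s) ^ θ)
            + C * (r' * (t - s) ^ θ') * r' ^ n := by
        field_simp; ring
      rw [this, ← f1, ← f2]
      linarith
  intro s t hs hst ht
  have lim : Filter.Tendsto
      (fun n : ℕ => K / (1 - r) * (t - s) ^ θ + C * (t - s) ^ θ' * r' ^ n) Filter.atTop
      (nhds (K / (1 - r) * (t - s) ^ θ + C * (t - s) ^ θ' * 0)) :=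
    ((tendsto_pow_atTop_nhds_zero_of_lt_one hr'0 hr').const_mul _).const_add _
  have := ge_of_tendsto' lim fun n => key n s t hs hst ht
  simpa using this

theorem sum_rpow_le_mul_sum {N : ℕ} {x : ℕ → ℝ} {m h κ : ℝ} (hκ : 0 < κ)
    (h0 : ∀ i < N, 0 ≤ x i) (hm : ∀ i < N, x i ≤ m) (hh : ∀ i < N, x i ≤ h) :
    ∑ i ∈ Finset.range N, x i ^ (1 + 2 * κ) ≤ m ^ κ * h ^ κ * ∑ i ∈ Finset.range N, x i := by
  rw [Finset.mul_sum]
  refine Finset.sum_le_sum fun i hi => ?_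
  have hi := Finset.mem_range.1 hi
  have e : x i ^ (1 + 2 * κ) = x i ^ κ * x i ^ κ * x i := by
    rw [Real.rpow_add_of_nonneg (h0 i hi) (by norm_num) (by linarith), Real.rpow_one, two_mul,
      Real.rpow_add_of_nonneg (h0 i hi) hκ.le hκ.le]
    ring
  rw [e]
  have := h0 i hi
  gcongr
  · exact Real.rpow_nonneg ((h0 i hi).trans (hm i hi)) _
  · exact hm i hi
  · exact hh i hi

theorem sum_range_two_mul {M : Type*} [AddCommMonoid M] (f : ℕ → M) (m : ℕ) :
    ∑ i ∈ Finset.range (2 * m), f i = ∑ i ∈ Finset.range m, (f (2 * i) + f (2 * i + 1)) := by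
  induction m with
  | zero => simp
  | succ m ih =>
    rw [show 2 * (m + 1) = 2 * m + 1 + 1 by ring, Finset.sum_range_succ, Finset.sum_range_succ, ih,
      Finset.sum_range_succ, add_assoc]

/-- Projection of the real line onto `[s,t]`. -/
def clampTo (s t x : ℝ) : ℝ := max s (min x t)

theorem le_clampTo (s t x : ℝ) : s ≤ clampTo s t x := le_max_left _ _

theorem clampTo_le {s t : ℝ} (h : s ≤ t) (x : ℝ) : clampTo s t x ≤ t :=
  max_le h (min_le_right _ _)

theorem clampTo_mono (s t : ℝ) : Monotone (clampTo s t) := fun _ _ h =>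
  max_le_max le_rfl (min_le_min h le_rfl)

theorem clampTo_sub_le {s t x y : ℝ} (h : x ≤ y) : clampTo s t y - clampTo s t x ≤ y - x := by
  unfold clampTo
  grind

theorem clampTo_of_le {s t x : ℝ} (h : x ≤ s) : clampTo s t x = s := by
  unfold clampTo; grind

theorem clampTo_of_ge {s t x : ℝ} (hst : s ≤ t) (h : t ≤ x) : clampTo s t x = t := by
  unfold clampTo; grind

theorem clampTo_eq_of_le {s u t x : ℝ} (h : x ≤ u) (hut : u ≤ t) :
    clampTo s u x = clampTo s t x := by
  unfold clampTo; rw [min_eq_left h, min_eq_left (h.trans hut)]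

theorem clampTo_eq_of_ge {s u t x : ℝ} (hsu : s ≤ u) (h : u ≤ x) (hut : u ≤ t) :
    clampTo u t x = clampTo s t x := by
  unfold clampTo
  rw [max_eq_right (le_min h hut), max_eq_right (hsu.trans (le_min h hut))]

/-- The points of the dyadic partition of `[a,b]` of level `n`. -/
noncomputable def dyadicPt (a b : ℝ) (n i : ℕ) : ℝ := a + (b - a) * (i / 2 ^ n)

theorem dyadicPt_mono {a b : ℝ} (hab : a ≤ b) (n : ℕ) : Monotone (dyadicPt a b n) := by
  intro i j hij
  unfold dyadicPt
  have : (i : ℝ) ≤ j := by exact_mod_cast hij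
  have : 0 ≤ b - a := by linarith
  gcongr

theorem dyadicPt_succ_sub (a b : ℝ) (n i : ℕ) :
    dyadicPt a b n (i + 1) - dyadicPt a b n i = (b - a) / 2 ^ n := by
  unfold dyadicPt; push_cast; ring

theorem dyadicPt_succ_two_mul (a b : ℝ) (n i : ℕ) :
    dyadicPt a b (n + 1) (2 * i) = dyadicPt a b n i := by
  unfold dyadicPt; push_cast; rw [pow_succ]; field_simp

/-- The sum of `Ξ` over the trace on `[s,t]` of the dyadic partition of `[a,b]` of level `n`. -/
noncomputable def dyadicSum (Ξ : ℝ → ℝ → E) (a b : ℝ) (n : ℕ) (s t : ℝ) : E :=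
  ∑ i ∈ Finset.range (2 ^ n),
    Ξ (clampTo s t (dyadicPt a b n i)) (clampTo s t (dyadicPt a b n (i + 1)))

theorem sum_clampTo_dyadicPt_rpow_le {a b s t κ : ℝ} (hκ : 0 < κ) (has : a ≤ s) (hst : s ≤ t)
    (htb : t ≤ b) (n : ℕ) :
    ∑ i ∈ Finset.range (2 ^ n), (clampTo s t (dyadicPt a b n (i + 1)) -
      clampTo s t (dyadicPt a b n i)) ^ (1 + 2 * κ) ≤
      ((b - a) / 2 ^ n) ^ κ * (t - s) ^ κ * (t - s) := by
  have hab : a ≤ b := by linarith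
  refine (sum_rpow_le_mul_sum (m := (b - a) / 2 ^ n) (h := t - s) hκ ?_ ?_ ?_).trans ?_
  · intro i _
    exact sub_nonneg.2 (clampTo_mono s t (dyadicPt_mono hab n i.le_succ))
  · intro i _
    rw [← dyadicPt_succ_sub a b n i]
    exact clampTo_sub_le (dyadicPt_mono hab n i.le_succ)
  · intro i _
    have := le_clampTo s t (dyadicPt a b n i)
    have := clampTo_le hst (dyadicPt a b n (i + 1))
    linarith
  · rw [Finset.sum_range_sub (fun i => clampTo s t (dyadicPt a b n i))]
    have h0 : clampTo s t (dyadicPt a b n 0) = s := clampTo_of_le (by simpa [dyadicPt] using has)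
    have h1 : clampTo s t (dyadicPt a b n (2 ^ n)) = t :=
      clampTo_of_ge hst (by simpa [dyadicPt] using htb)
    rw [h0, h1]

/-- The sewing lemma. -/
theorem exists_sewing [CompleteSpace E] {Ξ : ℝ → ℝ → E} {a b θ K : ℝ} (hθ : 1 < θ)
    (hΞ : ∀ s u t, a ≤ s → s ≤ u → u ≤ t → t ≤ b →
      ‖Ξ s t - Ξ s u - Ξ u t‖ ≤ K * (t - s) ^ θ) :
    ∃ I : ℝ → E, I a = 0 ∧ ∀ s t, a ≤ s → s ≤ t → t ≤ b →
      ‖I t - I s - Ξ s t‖ ≤ K / (1 - 2 ^ (1 - θ)) * (t - s) ^ θ := by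
  obtain ⟨κ, hκ, rfl⟩ : ∃ κ : ℝ, 0 < κ ∧ θ = 1 + 2 * κ := ⟨(θ - 1) / 2, by linarith, by ring⟩
  rcases lt_or_ge b a with hba | hab
  · exact ⟨0, rfl, fun s t h1 h2 h3 => by linarith⟩
  rcases eq_or_lt_of_le hab with rfl | hab'
  · refine ⟨0, rfl, fun s t h1 h2 h3 => ?_⟩
    obtain rfl : s = a := by linarith
    obtain rfl : t = s := by linarith
    have := hΞ t t t le_rfl le_rfl le_rfl le_rfl
    have h0 : (0 : ℝ) ^ (1 + 2 * κ) = 0 := Real.zero_rpow (by linarith)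
    rw [sub_self t, h0] at this ⊢
    simpa using this
  have hK : 0 ≤ K := by
    have := (norm_nonneg _).trans (hΞ a a b le_rfl le_rfl hab le_rfl)
    exact nonneg_of_mul_nonneg_left this (Real.rpow_pos_of_pos (by linarith) _)
  have hdiag : ∀ u, a ≤ u → u ≤ b → Ξ u u = 0 := by
    intro u h1 h2
    have := hΞ u u u h1 le_rfl le_rfl h2
    have h0 : (0 : ℝ) ^ (1 + 2 * κ) = 0 := Real.zero_rpow (by linarith)
    rw [sub_self u, h0] at this
    simpa using this
  set r : ℝ := (1 / 2) ^ κ with hr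
  have hr0 : 0 ≤ r := by positivity
  have hr1 : r < 1 := Real.rpow_lt_one (by norm_num) (by norm_num) hκ
  have hpow : ∀ n : ℕ, ((b - a) / 2 ^ n) ^ κ = (b - a) ^ κ * r ^ n := by
    intro n
    rw [div_eq_mul_one_div, Real.mul_rpow (by linarith) (by positivity), hr,
      ← one_div_pow, ← Real.rpow_natCast, ← Real.rpow_natCast, ← Real.rpow_mul (by norm_num),
      ← Real.rpow_mul (by norm_num), mul_comm κ]
  have hbd : ∀ s t, a ≤ s → s ≤ t → t ≤ b → ∀ n : ℕ, ∀ f : ℕ → E,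
      (∀ i, ‖f i‖ ≤ K * (clampTo s t (dyadicPt a b n (i + 1)) -
        clampTo s t (dyadicPt a b n i)) ^ (1 + 2 * κ)) →
      ‖∑ i ∈ Finset.range (2 ^ n), f i‖ ≤ K * (b - a) ^ κ * (t - s) ^ (1 + κ) * r ^ n := by
    intro s t hs hst ht n f hf
    refine (norm_sum_le_of_le _ fun i _ => hf i).trans ?_
    rw [← Finset.mul_sum]
    refine (mul_le_mul_of_nonneg_left (sum_clampTo_dyadicPt_rpow_le hκ hs hst ht n) hK).trans
      (le_of_eq ?_)
    rw [hpow, Real.rpow_add_of_nonneg (by linarith) (by norm_num) hκ.le, Real.rpow_one]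
    ring
  have hstep : ∀ s t, a ≤ s → s ≤ t → t ≤ b → ∀ n : ℕ,
      dist (dyadicSum Ξ a b n s t) (dyadicSum Ξ a b (n + 1) s t) ≤
        K * (b - a) ^ κ * (t - s) ^ (1 + κ) * r ^ n := by
    intro s t hs hst ht n
    rw [dist_eq_norm, dyadicSum, dyadicSum, pow_succ', sum_range_two_mul, ← Finset.sum_sub_distrib]
    refine hbd s t hs hst ht n _ fun i => ?_
    rw [show 2 * i + 1 + 1 = 2 * (i + 1) by ring, dyadicPt_succ_two_mul, dyadicPt_succ_two_mul,
      ← sub_sub]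
    have m1 : dyadicPt a b n i ≤ dyadicPt a b (n + 1) (2 * i + 1) := by
      rw [← dyadicPt_succ_two_mul]; exact dyadicPt_mono hab _ (Nat.le_succ _)
    have m2 : dyadicPt a b (n + 1) (2 * i + 1) ≤ dyadicPt a b n (i + 1) := by
      rw [← dyadicPt_succ_two_mul a b n (i + 1)]
      exact dyadicPt_mono hab _ (show 2 * i + 1 ≤ 2 * (i + 1) by omega)
    exact hΞ _ _ _ (hs.trans (le_clampTo _ _ _)) (clampTo_mono _ _ m1) (clampTo_mono _ _ m2)
      ((clampTo_le hst _).trans ht)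
  have hlim : ∀ s t, a ≤ s → s ≤ t → t ≤ b → ∃ J,
      Filter.Tendsto (fun n => dyadicSum Ξ a b n s t) Filter.atTop (nhds J) := fun s t hs hst ht =>
    cauchySeq_tendsto_of_complete (cauchySeq_of_le_geometric r _ hr1 (hstep s t hs hst ht))
  choose! J hJ using hlim
  have hclose : ∀ s t, a ≤ s → s ≤ t → t ≤ b →
      ‖J s t - Ξ s t‖ ≤ K * (b - a) ^ κ / (1 - r) * (t - s) ^ (1 + κ) := by
    intro s t hs hst ht
    have h := dist_le_of_le_geometric_of_tendsto₀ r _ hr1 (hstep s t hs hst ht) (hJ s t hs hst ht)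
    have e : dyadicSum Ξ a b 0 s t = Ξ s t := by
      simp only [dyadicSum, pow_zero, Finset.range_one, Finset.sum_singleton, zero_add]
      rw [clampTo_of_le (by simpa [dyadicPt] using hs),
        clampTo_of_ge hst (by simpa [dyadicPt] using ht)]
    rw [e, dist_comm, dist_eq_norm] at h
    refine h.trans (le_of_eq ?_)
    ring
  have hadd : ∀ s u t, a ≤ s → s ≤ u → u ≤ t → t ≤ b → J s t - J s u - J u t = 0 := by
    intro s u t hs hsu hut ht
    have hl := ((hJ s t hs (hsu.trans hut) ht).sub (hJ s u hs hsu (hut.trans ht))).sub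
      (hJ u t (hs.trans hsu) hut ht)
    refine tendsto_nhds_unique hl ?_
    refine squeeze_zero_norm (a := fun n => K * (b - a) ^ κ * (t - s) ^ (1 + κ) * r ^ n)
      (fun n => ?_) ?_
    · rw [dyadicSum, dyadicSum, dyadicSum, ← Finset.sum_sub_distrib, ← Finset.sum_sub_distrib]
      refine hbd s t hs (hsu.trans hut) ht n _ fun i => ?_
      have m := dyadicPt_mono hab n i.le_succ
      rw [Nat.succ_eq_add_one] at m
      generalize dyadicPt a b n i = x at m ⊢
      generalize dyadicPt a b n (i + 1) = y at m ⊢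
      have hst := hsu.trans hut
      have hnn : 0 ≤ K * (clampTo s t y - clampTo s t x) ^ (1 + 2 * κ) :=
        mul_nonneg hK (Real.rpow_nonneg (sub_nonneg.2 (clampTo_mono s t m)) _)
      have hduu := hdiag u (hs.trans hsu) (hut.trans ht)
      rcases le_total y u with hyu | huy
      · rw [clampTo_eq_of_le hyu hut, clampTo_eq_of_le (m.trans hyu) hut, clampTo_of_le hyu,
          clampTo_of_le (m.trans hyu), hduu, sub_self, sub_zero, norm_zero]
        exact hnn
      rcases le_total u x with hux | hxu
      · rw [clampTo_eq_of_ge hsu (hux.trans m) hut, clampTo_eq_of_ge hsu hux hut,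
          clampTo_of_ge hsu (hux.trans m), clampTo_of_ge hsu hux, hduu, sub_zero, sub_self,
          norm_zero]
        exact hnn
      · rw [clampTo_eq_of_le hxu hut, clampTo_eq_of_ge hsu huy hut, clampTo_of_ge hsu huy,
          clampTo_of_le hxu]
        refine hΞ _ _ _ (hs.trans (le_clampTo _ _ _)) ?_ ?_ ((clampTo_le hst _).trans ht)
        · rw [← clampTo_eq_of_le hxu hut]; exact clampTo_le hsu _
        · rw [← clampTo_eq_of_ge hsu huy hut]; exact le_clampTo _ _ _
    · simpa using (tendsto_pow_atTop_nhds_zero_of_lt_one hr0 hr1).const_mul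
        (K * (b - a) ^ κ * (t - s) ^ (1 + κ))
  refine ⟨J a, ?_, ?_⟩
  · simpa using hadd a a a le_rfl le_rfl le_rfl hab
  have hI : ∀ s t, a ≤ s → s ≤ t → t ≤ b → J a t - J a s = J s t := fun s t hs hst ht =>
    sub_eq_zero.1 (hadd a s t le_rfl hs hst ht)
  have hκ' : 1 < 1 + κ := by linarith
  refine norm_le_of_almost_additive (A := fun s t => J a t - J a s - Ξ s t) hθ hκ' ?_
    (C := K * (b - a) ^ κ / (1 - r)) ?_
  · intro s u t hs hsu hut ht
    rw [← norm_neg]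
    refine le_trans (le_of_eq (congrArg _ ?_)) (hΞ s u t hs hsu hut ht)
    abel
  · intro s t hs hst ht
    rw [hI s t hs hst ht]
    exact hclose s t hs hst ht

theorem IsPartition.le_of_le {s t : ℝ} {n : ℕ} {p : ℕ → ℝ} (hp : IsPartition s t n p) {i j : ℕ}
    (hij : i ≤ j) (hj : j ≤ n) : p i ≤ p j := by
  induction j, hij using Nat.le_induction with
  | base => exact le_rfl
  | succ j _ ih => exact (ih (by omega)).trans (hp.2.2 j (by omega)).le

/-- Riemann sums of a sewable germ are close to the sewn path. -/
theorem IsPartition.norm_sum_sub_le {Ξ : ℝ → ℝ → E} {I : ℝ → E} {a b s t κ C δ : ℝ} {n : ℕ}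
    {p : ℕ → ℝ} (hκ : 0 < κ) (hC : 0 ≤ C)
    (hI : ∀ s t, a ≤ s → s ≤ t → t ≤ b → ‖I t - I s - Ξ s t‖ ≤ C * (t - s) ^ (1 + 2 * κ))
    (hs : a ≤ s) (ht : t ≤ b) (hp : IsPartition s t n p) (hδ : ∀ i < n, p (i + 1) - p i < δ) :
    ‖∑ i ∈ Finset.range n, Ξ (p i) (p (i + 1)) - (I t - I s)‖ ≤ C * (δ ^ κ * δ ^ κ * (t - s)) := by
  have e : I t - I s = ∑ i ∈ Finset.range n, (I (p (i + 1)) - I (p i)) := by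
    rw [Finset.sum_range_sub (fun i => I (p i)), hp.1, hp.2.1]
  rw [e, ← norm_neg, neg_sub, ← Finset.sum_sub_distrib]
  refine (norm_sum_le_of_le (n := fun i => C * (p (i + 1) - p i) ^ (1 + 2 * κ)) _
    fun i hi => ?_).trans ?_
  · have hi := Finset.mem_range.1 hi
    refine hI _ _ ?_ (hp.2.2 i hi).le ?_
    · rw [← hp.1] at hs; exact hs.trans (hp.le_of_le (Nat.zero_le i) hi.le)
    · rw [← hp.2.1] at ht; exact (hp.le_of_le (Nat.succ_le_of_lt hi) le_rfl).trans ht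
  · rw [← Finset.mul_sum]
    refine mul_le_mul_of_nonneg_left ?_ hC
    refine (sum_rpow_le_mul_sum hκ (fun i hi => sub_nonneg.2 (hp.2.2 i hi).le)
      (fun i hi => (hδ i hi).le) (fun i hi => (hδ i hi).le)).trans (le_of_eq ?_)
    rw [Finset.sum_range_sub, hp.1, hp.2.1]

/-- Partitions of arbitrarily small mesh exist. -/
theorem exists_isPartition {s t δ : ℝ} (hst : s ≤ t) (hδ : 0 < δ) :
    ∃ (n : ℕ) (p : ℕ → ℝ), IsPartition s t n p ∧ ∀ i < n, p (i + 1) - p i < δ := by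
  rcases eq_or_lt_of_le hst with rfl | hst
  · exact ⟨0, fun _ => s, ⟨rfl, rfl, by simp⟩, by simp⟩
  obtain ⟨n, hn⟩ := exists_nat_gt ((t - s) / δ)
  have hn0 : (0 : ℝ) < n := lt_of_le_of_lt (by positivity [sub_pos.2 hst]) hn
  have hstep : ∀ i : ℕ, s + (t - s) * ((i + 1 : ℕ) / n) - (s + (t - s) * (i / n)) = (t - s) / n := by
    intro i; push_cast; ring
  refine ⟨n, fun i => s + (t - s) * (i / n), ⟨by simp, ?_, fun i _ => ?_⟩, fun i _ => ?_⟩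
  · field_simp; ring
  · have := hstep i
    have := div_pos (sub_pos.2 hst) hn0
    linarith
  · rw [hstep]
    rw [div_lt_iff₀ hδ] at hn
    rw [div_lt_iff₀ hn0]
    linarith

end Sewing

section Germ

variable {V V2 W U : Type*}
  [NormedAddCommGroup V] [NormedSpace ℝ V] [NormedAddCommGroup V2] [NormedSpace ℝ V2]
  [NormedAddCommGroup W] [NormedSpace ℝ W] [NormedAddCommGroup U] [NormedSpace ℝ U]

/-- The local approximation of the rough integral of `(G, A)` against `(Z, Z')`. -/
noncomputable def germ (tops : TensorOps V V2 U W) (XX : ℝ → ℝ → V2) (Z : ℝ → U) (Z' : ℝ → V →L[ℝ] U)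
    (G : ℝ → U →L[ℝ] W) (A : ℝ → V →L[ℝ] (U →L[ℝ] W)) (s t : ℝ) : W :=
  G s (Z t - Z s) + tops.spair (A s) (Z' s) (XX s t)

theorem germ_sub (tops : TensorOps V V2 U W) (XX : ℝ → ℝ → V2) (Z : ℝ → U)
    (Z' : ℝ → V →L[ℝ] U) (G H : ℝ → U →L[ℝ] W) (A B : ℝ → V →L[ℝ] (U →L[ℝ] W)) (s t : ℝ) :
    germ tops XX Z Z' (fun r => G r - H r) (fun r => A r - B r) s t =
      germ tops XX Z Z' G A s t - germ tops XX Z Z' H B s t := by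
  simp only [germ, map_sub, sub_apply]
  abel

/-- A path approximated by the germ to an order greater than one is given by rough integrals. -/
theorem isRoughIntegral_of_germ {tops : TensorOps V V2 U W} {XX : ℝ → ℝ → V2} {Z : ℝ → U}
    {Z' : ℝ → V →L[ℝ] U} {G : ℝ → U →L[ℝ] W} {A : ℝ → V →L[ℝ] (U →L[ℝ] W)} {Q : ℝ → W}
    {a b s t θ C : ℝ} (hθ : 1 < θ)
    (hQ : ∀ s t, a ≤ s → s ≤ t → t ≤ b →
      ‖Q t - Q s - germ tops XX Z Z' G A s t‖ ≤ C * (t - s) ^ θ)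
    (hs : a ≤ s) (hst : s ≤ t) (ht : t ≤ b) :
    IsRoughIntegral tops XX G A Z Z' s t (Q t - Q s) := by
  intro ε hε
  obtain ⟨κ, hκ, rfl⟩ : ∃ κ : ℝ, 0 < κ ∧ θ = 1 + 2 * κ := ⟨(θ - 1) / 2, by linarith, by ring⟩
  have hQ' : ∀ s t, a ≤ s → s ≤ t → t ≤ b →
      ‖Q t - Q s - germ tops XX Z Z' G A s t‖ ≤ |C| * (t - s) ^ (1 + 2 * κ) :=
    fun s t hs hst ht => (hQ s t hs hst ht).trans
      (mul_le_mul_of_nonneg_right (le_abs_self C) (Real.rpow_nonneg (sub_nonneg.2 hst) _))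
  obtain ⟨c, hc⟩ : ∃ c, c = |C| * (t - s) + 1 := ⟨_, rfl⟩
  have hc0 : 0 < c := by
    have := mul_nonneg (abs_nonneg C) (sub_nonneg.2 hst)
    linarith
  have hδ : (((ε / c) ^ (2 * κ)⁻¹) ^ κ) * (((ε / c) ^ (2 * κ)⁻¹) ^ κ) = ε / c := by
    rw [← Real.rpow_add (by positivity), ← two_mul,
      Real.rpow_inv_rpow (by positivity) (by positivity)]
  refine ⟨(ε / c) ^ (2 * κ)⁻¹, by positivity, fun n p hp hmesh => ?_⟩
  refine (hp.norm_sum_sub_le hκ (abs_nonneg C) hQ' hs ht hmesh).trans ?_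
  rw [hδ, div_mul_eq_mul_div, mul_div_assoc', div_le_iff₀ hc0, hc]
  nlinarith

theorem IsRoughIntegral.unique {tops : TensorOps V V2 U W} {XX : ℝ → ℝ → V2} {Z : ℝ → U}
    {Z' : ℝ → V →L[ℝ] U} {G : ℝ → U →L[ℝ] W} {A : ℝ → V →L[ℝ] (U →L[ℝ] W)} {s t : ℝ} {I J : W}
    (hst : s ≤ t) (hI : IsRoughIntegral tops XX G A Z Z' s t I)
    (hJ : IsRoughIntegral tops XX G A Z Z' s t J) : I = J := by
  rw [← sub_eq_zero, ← norm_le_zero_iff]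
  refine le_of_forall_pos_le_add fun ε hε => ?_
  obtain ⟨δ, hδ, h1⟩ := hI (ε / 2) (by positivity)
  obtain ⟨δ', hδ', h2⟩ := hJ (ε / 2) (by positivity)
  obtain ⟨n, p, hp, hm⟩ := exists_isPartition hst (lt_min hδ hδ')
  have h1 := h1 n p hp fun i hi => (hm i hi).trans_le (min_le_left _ _)
  have h2 := h2 n p hp fun i hi => (hm i hi).trans_le (min_le_right _ _)
  rw [norm_sub_rev] at h1
  calc ‖I - J‖ ≤ ‖I - rsum tops XX G A Z Z' n p‖ + ‖rsum tops XX G A Z Z' n p - J‖ :=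
        norm_sub_le_norm_sub_add_norm_sub _ _ _
    _ ≤ 0 + ε := by linarith

end Germ

section Controlled

variable {V E : Type*} [NormedAddCommGroup V] [NormedSpace ℝ V]
  [NormedAddCommGroup E] [NormedSpace ℝ E]

/-- Both Hölder seminorms of the controlled path `(Y, Y')` on `[a,b]` are at most `d`. -/
structure CtrlSeminormLE (α a b : ℝ) (X : ℝ → V) (d : ℝ) (Y : ℝ → E) (Y' : ℝ → V →L[ℝ] E) :
    Prop where
  deriv : ∀ s t, a ≤ s → s ≤ t → t ≤ b → ‖Y' t - Y' s‖ ≤ d * (t - s) ^ α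
  rem : ∀ s t, a ≤ s → s ≤ t → t ≤ b → ‖Rem X Y Y' s t‖ ≤ d * ((t - s) ^ α) ^ 2

/-- `(Y, Y')` has controlled seminorm at most `d` on `[a,b]`, and `Y`, `Y'` and the `α`-Hölder
seminorm of `Y` are at most `e`. -/
structure CtrlBound (α a b : ℝ) (X : ℝ → V) (e d : ℝ) (Y : ℝ → E) (Y' : ℝ → V →L[ℝ] E) : Prop
    extends CtrlSeminormLE α a b X d Y Y' where
  val : ∀ s, a ≤ s → s ≤ b → ‖Y s‖ ≤ e
  deriv_val : ∀ s, a ≤ s → s ≤ b → ‖Y' s‖ ≤ e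
  incr : ∀ s t, a ≤ s → s ≤ t → t ≤ b → ‖Y t - Y s‖ ≤ e * (t - s) ^ α

variable {α a b e d M L : ℝ} {X : ℝ → V} {Y Yt : ℝ → E} {Y' Yt' : ℝ → V →L[ℝ] E}

theorem CtrlSeminormLE.mono {d' : ℝ} (h : CtrlSeminormLE α a b X d Y Y') (hd : d ≤ d') :
    CtrlSeminormLE α a b X d' Y Y' where
  deriv s t hs hst ht := (h.deriv s t hs hst ht).trans
    (mul_le_mul_of_nonneg_right hd (Real.rpow_nonneg (sub_nonneg.2 hst) _))
  rem s t hs hst ht := (h.rem s t hs hst ht).trans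
    (mul_le_mul_of_nonneg_right hd (by positivity))

theorem CtrlBound.mono {e' d' : ℝ} (h : CtrlBound α a b X e d Y Y') (he : e ≤ e') (hd : d ≤ d') :
    CtrlBound α a b X e' d' Y Y' where
  toCtrlSeminormLE := h.toCtrlSeminormLE.mono hd
  val s h1 h2 := (h.val s h1 h2).trans he
  deriv_val s h1 h2 := (h.deriv_val s h1 h2).trans he
  incr s t hs hst ht := (h.incr s t hs hst ht).trans
    (mul_le_mul_of_nonneg_right he (Real.rpow_nonneg (sub_nonneg.2 hst) _))

theorem CtrlBound.restrict {a' b' : ℝ} (h : CtrlBound α a b X e d Y Y') (ha : a ≤ a')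
    (hb : b' ≤ b) : CtrlBound α a' b' X e d Y Y' where
  deriv s t hs hst ht := h.deriv s t (ha.trans hs) hst (ht.trans hb)
  rem s t hs hst ht := h.rem s t (ha.trans hs) hst (ht.trans hb)
  val s h1 h2 := h.val s (ha.trans h1) (h2.trans hb)
  deriv_val s h1 h2 := h.deriv_val s (ha.trans h1) (h2.trans hb)
  incr s t hs hst ht := h.incr s t (ha.trans hs) hst (ht.trans hb)

theorem CtrlSeminormLE.congr (h : CtrlSeminormLE α a b X d Y Y')
    (h1 : ∀ t, a ≤ t → t ≤ b → Yt t = Y t) (h2 : ∀ t, a ≤ t → t ≤ b → Yt' t = Y' t) :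
    CtrlSeminormLE α a b X d Yt Yt' where
  deriv s t hs hst ht := by
    rw [h2 s hs (hst.trans ht), h2 t (hs.trans hst) ht]
    exact h.deriv s t hs hst ht
  rem s t hs hst ht := by
    have := h.rem s t hs hst ht
    unfold Rem at this ⊢
    rwa [h2 s hs (hst.trans ht), h1 s hs (hst.trans ht), h1 t (hs.trans hst) ht]

theorem Rem_sub (X : ℝ → V) (Y Yt : ℝ → E) (Y' Yt' : ℝ → V →L[ℝ] E) (s t : ℝ) :
    Rem X (fun r => Y r - Yt r) (fun r => Y' r - Yt' r) s t = Rem X Y Y' s t - Rem X Yt Yt' s t := by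
  simp only [Rem, sub_apply]; abel

theorem Rem_add (X : ℝ → V) (Y Yt : ℝ → E) (Y' Yt' : ℝ → V →L[ℝ] E) (s t : ℝ) :
    Rem X (fun r => Y r + Yt r) (fun r => Y' r + Yt' r) s t = Rem X Y Y' s t + Rem X Yt Yt' s t := by
  simp only [Rem, add_apply]; abel

theorem CtrlSeminormLE.sub {d' : ℝ} (h : CtrlSeminormLE α a b X d Y Y')
    (h' : CtrlSeminormLE α a b X d' Yt Yt') :
    CtrlSeminormLE α a b X (d + d') (fun r => Y r - Yt r) (fun r => Y' r - Yt' r) where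
  deriv s t hs hst ht := by
    rw [sub_sub_sub_comm, add_mul]
    exact norm_sub_le_of_le (h.deriv s t hs hst ht) (h'.deriv s t hs hst ht)
  rem s t hs hst ht := by
    rw [Rem_sub, add_mul]
    exact norm_sub_le_of_le (h.rem s t hs hst ht) (h'.rem s t hs hst ht)

theorem CtrlSeminormLE.add {d' : ℝ} (h : CtrlSeminormLE α a b X d Y Y')
    (h' : CtrlSeminormLE α a b X d' Yt Yt') :
    CtrlSeminormLE α a b X (d + d') (fun r => Y r + Yt r) (fun r => Y' r + Yt' r) where
  deriv s t hs hst ht := by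
    rw [add_sub_add_comm, add_mul]
    exact norm_add_le_of_le (h.deriv s t hs hst ht) (h'.deriv s t hs hst ht)
  rem s t hs hst ht := by
    rw [Rem_add, add_mul]
    exact norm_add_le_of_le (h.rem s t hs hst ht) (h'.rem s t hs hst ht)

/-- Seminorm bounds are preserved by pointwise limits. -/
theorem CtrlSeminormLE.of_tendsto {Yn : ℕ → ℝ → E} {Yn' : ℕ → ℝ → V →L[ℝ] E}
    (h : ∀ᶠ n in Filter.atTop, CtrlSeminormLE α a b X d (Yn n) (Yn' n))
    (h1 : ∀ t, a ≤ t → t ≤ b → Filter.Tendsto (fun n => Yn n t) Filter.atTop (nhds (Y t)))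
    (h2 : ∀ t, a ≤ t → t ≤ b → Filter.Tendsto (fun n => Yn' n t) Filter.atTop (nhds (Y' t))) :
    CtrlSeminormLE α a b X d Y Y' where
  deriv s t hs hst ht :=
    le_of_tendsto ((h2 t (hs.trans hst) ht).sub (h2 s hs (hst.trans ht))).norm
      (h.mono fun _ hn => hn.deriv s t hs hst ht)
  rem s t hs hst ht :=
    le_of_tendsto (((h1 t (hs.trans hst) ht).sub (h1 s hs (hst.trans ht))).sub
      (((ContinuousLinearMap.apply ℝ E (X t - X s)).continuous.tendsto _).comp
        (h2 s hs (hst.trans ht)))).norm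
      (h.mono fun _ hn => hn.rem s t hs hst ht)

theorem rpow_sub_le_rpow_sub {s t : ℝ} (hα : 0 < α) (hs : a ≤ s) (hst : s ≤ t) (ht : t ≤ b) :
    (t - s) ^ α ≤ (b - a) ^ α :=
  Real.rpow_le_rpow (sub_nonneg.2 hst) (by linarith) hα.le

/-- The values of a controlled path are bounded by its initial values and its seminorm. -/
theorem CtrlSeminormLE.ctrlBound (hα : 0 < α) (hL : 0 ≤ L) (hM : 0 ≤ M) (hd : 0 ≤ d)
    (hab : b - a ≤ 1)
    (hX : ∀ s t, a ≤ s → s ≤ t → t ≤ b → ‖X t - X s‖ ≤ L * (t - s) ^ α)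
    (h : CtrlSeminormLE α a b X d Y Y') (h0 : ‖Y a‖ ≤ M) (h0' : ‖Y' a‖ ≤ M) :
    CtrlBound α a b X ((M + d * (b - a) ^ α) * (1 + L)) d Y Y' := by
  have hη : a ≤ b → 0 ≤ (b - a) ^ α := fun hab => Real.rpow_nonneg (sub_nonneg.2 hab) _
  have hη1 : a ≤ b → (b - a) ^ α ≤ 1 := fun hab' =>
    Real.rpow_le_one (sub_nonneg.2 hab') hab hα.le
  have hw : ∀ s t, a ≤ s → s ≤ t → t ≤ b → (t - s) ^ α ≤ (b - a) ^ α :=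
    fun s t => rpow_sub_le_rpow_sub hα
  have hdv : ∀ s, a ≤ s → s ≤ b → ‖Y' s‖ ≤ M + d * (b - a) ^ α := fun s h1 h2 => by
    have e : Y' s = Y' a + (Y' s - Y' a) := by abel
    rw [e]
    refine norm_add_le_of_le h0' ((h.deriv a s le_rfl h1 h2).trans ?_)
    exact mul_le_mul_of_nonneg_left (hw a s le_rfl h1 h2) hd
  have hinc : ∀ s t, a ≤ s → s ≤ t → t ≤ b →
      ‖Y t - Y s‖ ≤ ((M + d * (b - a) ^ α) * L + d * (b - a) ^ α) * (t - s) ^ α := by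
    intro s t hs hst ht
    have e : Y t - Y s = Y' s (X t - X s) + Rem X Y Y' s t := by simp only [Rem]; abel
    have hw0 : 0 ≤ (t - s) ^ α := Real.rpow_nonneg (sub_nonneg.2 hst) _
    rw [e]
    refine (norm_add_le_of_le (ContinuousLinearMap.le_of_opNorm_le_of_le _
      (hdv s hs (hst.trans ht)) (hX s t hs hst ht)) (h.rem s t hs hst ht)).trans ?_
    have := mul_le_mul_of_nonneg_left (hw s t hs hst ht) (mul_nonneg hd hw0)
    nlinarith
  refine ⟨h, fun s h1 h2 => ?_, fun s h1 h2 => ?_, fun s t hs hst ht => ?_⟩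
  · have e : Y s = Y a + (Y s - Y a) := by abel
    have hη := hη (h1.trans h2)
    have h3 := hinc a s le_rfl h1 h2
    have hs1 : (s - a) ^ α ≤ 1 := (hw a s le_rfl h1 h2).trans (hη1 (h1.trans h2))
    have hc : 0 ≤ (M + d * (b - a) ^ α) * L + d * (b - a) ^ α := by positivity
    rw [e]
    refine (norm_add_le_of_le h0 h3).trans ?_
    have := mul_le_mul_of_nonneg_left hs1 hc
    linarith
  · have hη := hη (h1.trans h2)
    have : 0 ≤ (M + d * (b - a) ^ α) * L := by positivity
    have := hdv s h1 h2
    linarith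
  · refine (hinc s t hs hst ht).trans (mul_le_mul_of_nonneg_right ?_
      (Real.rpow_nonneg (sub_nonneg.2 hst) _))
    linarith

end Controlled

section Integration

variable {V V2 W U : Type*}
  [NormedAddCommGroup V] [NormedSpace ℝ V] [NormedAddCommGroup V2] [NormedSpace ℝ V2]
  [NormedAddCommGroup W] [NormedSpace ℝ W] [NormedAddCommGroup U] [NormedSpace ℝ U]

/-- All quantities attached to the rough path `(X, XX)` and the controlled integrator `(Z, Z')` are
bounded by `L` on `[0,T]`. -/
structure DriverBound (T α L : ℝ) (tops : TensorOps V V2 U W) (X : ℝ → V) (XX : ℝ → ℝ → V2)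
    (Z : ℝ → U) (Z' : ℝ → V →L[ℝ] U) : Prop where
  chen : ∀ s u t : ℝ, 0 ≤ s → s ≤ u → u ≤ t → t ≤ T →
    XX s t = XX s u + XX u t + tops.tmul (X u - X s) (X t - X u)
  path : ∀ s t, 0 ≤ s → s ≤ t → t ≤ T → ‖X t - X s‖ ≤ L * (t - s) ^ α
  area : ∀ s t, 0 ≤ s → s ≤ t → t ≤ T → ‖XX s t‖ ≤ L * ((t - s) ^ α) ^ 2
  ctrl : CtrlBound α 0 T X L L Z Z'

variable {T α L a b e d : ℝ} {tops : TensorOps V V2 U W} {X : ℝ → V} {XX : ℝ → ℝ → V2}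
  {Z : ℝ → U} {Z' : ℝ → V →L[ℝ] U} {G : ℝ → U →L[ℝ] W} {A : ℝ → V →L[ℝ] (U →L[ℝ] W)}

theorem rpow_pow_three {x : ℝ} (hx : 0 ≤ x) (α : ℝ) : (x ^ α) ^ 3 = x ^ (3 * α) := by
  rw [mul_comm, Real.rpow_mul hx]; norm_cast

theorem norm_spair_apply_le {x y z : ℝ} (P : V →L[ℝ] (U →L[ℝ] W)) (B : V →L[ℝ] U) (v : V2)
    (hP : ‖P‖ ≤ x) (hB : ‖B‖ ≤ y) (hv : ‖v‖ ≤ z) : ‖tops.spair P B v‖ ≤ x * y * z :=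
  ContinuousLinearMap.le_of_opNorm_le_of_le _
    ((tops.spair_le P B).trans (mul_le_mul hP hB (norm_nonneg _) ((norm_nonneg P).trans hP))) hv

/-- The defect of additivity of the germ. -/
theorem DriverBound.norm_germ_defect_le (hD : DriverBound T α L tops X XX Z Z') (hα : 0 < α)
    (hL : 0 ≤ L) (he : 0 ≤ e) (hd : 0 ≤ d) (h : CtrlBound α a b X e d G A) (ha : 0 ≤ a)
    (hb : b ≤ T) (s u t : ℝ) (hs : a ≤ s) (hsu : s ≤ u) (hut : u ≤ t) (ht : t ≤ b) :
    ‖germ tops XX Z Z' G A s t - germ tops XX Z Z' G A s u - germ tops XX Z Z' G A u t‖ ≤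
      (L + 2 * L ^ 2 + L ^ 3) * (e + d) * (t - s) ^ (3 * α) := by
  have hst := hsu.trans hut
  have key : germ tops XX Z Z' G A s t - germ tops XX Z Z' G A s u - germ tops XX Z Z' G A u t =
      -(Rem X G A s u (Z t - Z u)) - A s (X u - X s) (Rem X Z Z' u t) -
        A s (X u - X s) ((Z' u - Z' s) (X t - X u)) - tops.spair (A u - A s) (Z' u) (XX u t) -
        tops.spair (A s) (Z' u - Z' s) (XX u t) := by
    have e1 := hD.chen s u t (ha.trans hs) hsu hut (ht.trans hb)
    simp only [germ, e1, Rem, map_sub, map_add, sub_apply,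
      tops.spair_tmul]
    abel
  have hw0 : 0 ≤ (t - s) ^ α := Real.rpow_nonneg (sub_nonneg.2 hst) _
  have w1 : (u - s) ^ α ≤ (t - s) ^ α := rpow_sub_le_rpow_sub hα le_rfl hsu hut
  have w2 : (t - u) ^ α ≤ (t - s) ^ α := rpow_sub_le_rpow_sub hα hsu hut le_rfl
  have w10 : 0 ≤ (u - s) ^ α := Real.rpow_nonneg (sub_nonneg.2 hsu) _
  have w20 : 0 ≤ (t - u) ^ α := Real.rpow_nonneg (sub_nonneg.2 hut) _
  have hs0 := ha.trans hs
  have hu0 := hs0.trans hsu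
  have hua := hs.trans hsu
  have htT := ht.trans hb
  have huT := hut.trans htT
  have hub := hut.trans ht
  rw [key, ← rpow_pow_three (sub_nonneg.2 hst)]
  generalize (t - s) ^ α = w at *
  have x1 : ‖X u - X s‖ ≤ L * w :=
    (hD.path s u hs0 hsu huT).trans (mul_le_mul_of_nonneg_left w1 hL)
  have x2 : ‖X t - X u‖ ≤ L * w :=
    (hD.path u t hu0 hut htT).trans (mul_le_mul_of_nonneg_left w2 hL)
  have z2 : ‖Z t - Z u‖ ≤ L * w :=
    (hD.ctrl.incr u t hu0 hut htT).trans (mul_le_mul_of_nonneg_left w2 hL)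
  have z1 : ‖Z' u - Z' s‖ ≤ L * w :=
    (hD.ctrl.deriv s u hs0 hsu huT).trans (mul_le_mul_of_nonneg_left w1 hL)
  have z3 : ‖Z' u‖ ≤ L := hD.ctrl.deriv_val u hu0 huT
  have rz : ‖Rem X Z Z' u t‖ ≤ L * w ^ 2 := (hD.ctrl.rem u t hu0 hut htT).trans (by gcongr)
  have xx : ‖XX u t‖ ≤ L * w ^ 2 := (hD.area u t hu0 hut htT).trans (by gcongr)
  have rg : ‖Rem X G A s u‖ ≤ d * w ^ 2 := (h.rem s u hs hsu hub).trans (by gcongr)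
  have a1 : ‖A u - A s‖ ≤ d * w := (h.deriv s u hs hsu hub).trans (by gcongr)
  have a0 : ‖A s‖ ≤ e := h.deriv_val s hs (hsu.trans hub)
  have ax := ContinuousLinearMap.le_of_opNorm_le_of_le _ a0 x1
  have b1 := ContinuousLinearMap.le_of_opNorm_le_of_le _ rg z2
  have b2 := ContinuousLinearMap.le_of_opNorm_le_of_le _ ax rz
  have b3 := ContinuousLinearMap.le_of_opNorm_le_of_le _ ax
    (ContinuousLinearMap.le_of_opNorm_le_of_le _ z1 x2)
  have b4 := norm_spair_apply_le (tops := tops) _ _ _ a1 z3 xx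
  have b5 := norm_spair_apply_le (tops := tops) _ _ _ a0 z1 xx
  rw [← norm_neg] at b1
  refine (norm_sub_le_of_le (norm_sub_le_of_le (norm_sub_le_of_le (norm_sub_le_of_le b1 b2) b3) b4)
    b5).trans ?_
  have e1 : (L + 2 * L ^ 2 + L ^ 3) * (e + d) * w ^ 3 - (d * w ^ 2 * (L * w) +
      e * (L * w) * (L * w ^ 2) + e * (L * w) * (L * w * (L * w)) + d * w * L * (L * w ^ 2) +
      e * (L * w) * (L * w ^ 2)) = (L * e + d * (L ^ 2 + L ^ 3)) * w ^ 3 := by ring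
  have : 0 ≤ (L * e + d * (L ^ 2 + L ^ 3)) * w ^ 3 := by positivity
  linarith

/-- The constant in the bound on the rough integral as a controlled path. -/
noncomputable def integralConst (α L : ℝ) : ℝ :=
  (L + 2 * L ^ 2 + L ^ 3) / (1 - 2 ^ (1 - 3 * α)) + 2 * L + L ^ 2

theorem one_sub_two_rpow_pos (hα : 1 / 3 < α) : 0 < 1 - (2 : ℝ) ^ (1 - 3 * α) :=
  sub_pos.2 (Real.rpow_lt_one_of_one_lt_of_neg (by norm_num) (by linarith))

theorem integralConst_nonneg (hα : 1 / 3 < α) (hL : 0 ≤ L) : 0 ≤ integralConst α L := by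
  have := one_sub_two_rpow_pos hα
  unfold integralConst
  positivity

/-- The rough integral of a controlled path is a controlled path, with a quantitative bound. -/
theorem DriverBound.ctrlSeminormLE_integral (hD : DriverBound T α L tops X XX Z Z')
    (hα : 1 / 3 < α) (hL : 0 ≤ L) (he : 0 ≤ e) (hd : 0 ≤ d) (h : CtrlBound α a b X e d G A)
    (ha : 0 ≤ a) (hb : b ≤ T) (hab : b - a ≤ 1) {Q : ℝ → W} {K : ℝ}
    (hQ : ∀ s t, a ≤ s → s ≤ t → t ≤ b →
      ‖Q t - Q s - germ tops XX Z Z' G A s t‖ ≤ K * (t - s) ^ (3 * α)) :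
    CtrlSeminormLE α a b X (integralConst α L * (e + d * (b - a) ^ α)) Q
      (fun t => (G t).comp (Z' t)) := by
  have hα0 : 0 < α := by linarith
  have hpos := one_sub_two_rpow_pos hα
  have hθ : 1 < 3 * α := by linarith
  have hQ' := norm_le_of_almost_additive (A := fun s t => Q t - Q s - germ tops XX Z Z' G A s t)
    (K := (L + 2 * L ^ 2 + L ^ 3) * (e + d)) hθ hθ (fun s u t hs hsu hut ht => by
      rw [← norm_neg]
      refine le_trans (le_of_eq (congrArg _ ?_))
        (hD.norm_germ_defect_le hα0 hL he hd h ha hb s u t hs hsu hut ht)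
      abel) hQ
  have hc : 2 * L + L ^ 2 ≤ integralConst α L := by
    have : 0 ≤ (L + 2 * L ^ 2 + L ^ 3) / (1 - 2 ^ (1 - 3 * α)) := by positivity
    unfold integralConst; linarith
  constructor
  · intro s t hs hst ht
    have hη : 0 ≤ (b - a) ^ α := Real.rpow_nonneg (by linarith) _
    have hw : 0 ≤ (t - s) ^ α := Real.rpow_nonneg (sub_nonneg.2 hst) _
    have e1 : (G t).comp (Z' t) - (G s).comp (Z' s) =
        (G t - G s).comp (Z' t) + (G s).comp (Z' t - Z' s) := by
      simp only [ContinuousLinearMap.comp_sub, ContinuousLinearMap.sub_comp]; abel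
    rw [e1]
    have b1 : ‖(G t - G s).comp (Z' t)‖ ≤ e * (t - s) ^ α * L :=
      (ContinuousLinearMap.opNorm_comp_le _ _).trans
        (mul_le_mul (h.incr s t hs hst ht)
          (hD.ctrl.deriv_val t (by linarith) (by linarith)) (norm_nonneg _) (by positivity))
    have b2 : ‖(G s).comp (Z' t - Z' s)‖ ≤ e * (L * (t - s) ^ α) :=
      (ContinuousLinearMap.opNorm_comp_le _ _).trans
        (mul_le_mul (h.val s hs (by linarith))
          (hD.ctrl.deriv s t (by linarith) hst (by linarith)) (norm_nonneg _) he)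
    refine (norm_add_le_of_le b1 b2).trans ?_
    have h1 : 2 * L ≤ integralConst α L := by nlinarith
    have h2 : e ≤ e + d * (b - a) ^ α := by nlinarith
    calc e * (t - s) ^ α * L + e * (L * (t - s) ^ α) = 2 * L * e * (t - s) ^ α := by ring
      _ ≤ _ := by gcongr; linarith
  · intro s t hs hst ht
    have hη : 0 ≤ (b - a) ^ α := Real.rpow_nonneg (by linarith) _
    have hη1 : (b - a) ^ α ≤ 1 := Real.rpow_le_one (by linarith) hab hα0.le
    have hw : 0 ≤ (t - s) ^ α := Real.rpow_nonneg (sub_nonneg.2 hst) _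
    have hwη : (t - s) ^ α ≤ (b - a) ^ α := rpow_sub_le_rpow_sub hα0 hs hst ht
    have e1 : Rem X Q (fun t => (G t).comp (Z' t)) s t =
        (Q t - Q s - germ tops XX Z Z' G A s t) + G s (Rem X Z Z' s t) +
          tops.spair (A s) (Z' s) (XX s t) := by
      simp only [Rem, germ, map_sub, ContinuousLinearMap.comp_apply]; abel
    have b1 := hQ' s t hs hst ht
    rw [← rpow_pow_three (sub_nonneg.2 hst)] at b1
    have b2 := ContinuousLinearMap.le_of_opNorm_le_of_le _ (h.val s hs (by linarith))
      (hD.ctrl.rem s t (by linarith) hst (by linarith))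
    have b3 := norm_spair_apply_le (tops := tops) _ _ _ (h.deriv_val s hs (by linarith))
      (hD.ctrl.deriv_val s (by linarith) (by linarith))
      (hD.area s t (by linarith) hst (by linarith))
    rw [e1]
    refine (norm_add_le_of_le (norm_add_le_of_le b1 b2) b3).trans ?_
    generalize (t - s) ^ α = w at *
    generalize (b - a) ^ α = η at *
    have h1 : (e + d) * w ≤ e + d * η := by nlinarith
    have h2 : e ≤ e + d * η := by nlinarith
    have hC : 0 ≤ (L + 2 * L ^ 2 + L ^ 3) / (1 - 2 ^ (1 - 3 * α)) := by positivity
    calc (L + 2 * L ^ 2 + L ^ 3) * (e + d) / (1 - 2 ^ (1 - 3 * α)) * w ^ 3 + e * (L * w ^ 2) +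
          e * L * (L * w ^ 2)
        = (L + 2 * L ^ 2 + L ^ 3) / (1 - 2 ^ (1 - 3 * α)) * ((e + d) * w) * w ^ 2 +
          (L + L ^ 2) * e * w ^ 2 := by ring
      _ ≤ (L + 2 * L ^ 2 + L ^ 3) / (1 - 2 ^ (1 - 3 * α)) * (e + d * η) * w ^ 2 +
          (2 * L + L ^ 2) * (e + d * η) * w ^ 2 := by gcongr; linarith
      _ = integralConst α L * (e + d * η) * w ^ 2 := by unfold integralConst; ring

end Integration

section Composition

variable {W E : Type*} [NormedAddCommGroup W] [NormedSpace ℝ W]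
  [NormedAddCommGroup E] [NormedSpace ℝ E]

theorem norm_sub_le_of_norm_hasFDerivAt_le {F : W → E} {F₁ : W → W →L[ℝ] E} {L : ℝ}
    (hF : ∀ x, HasFDerivAt F (F₁ x) x) (hL : ∀ x, ‖F₁ x‖ ≤ L) (x y : W) :
    ‖F y - F x‖ ≤ L * ‖y - x‖ :=
  convex_univ.norm_image_sub_le_of_norm_hasFDerivWithin_le
    (fun x _ => (hF x).hasFDerivWithinAt) (fun x _ => hL x) (Set.mem_univ x) (Set.mem_univ y)

/-- First order four-point estimate. -/
theorem norm_four_point_le {F : W → E} {F₁ : W → W →L[ℝ] E} {L : ℝ}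
    (hF : ∀ x, HasFDerivAt F (F₁ x) x) (hL : ∀ x, ‖F₁ x‖ ≤ L)
    (hLip : ∀ x y, ‖F₁ y - F₁ x‖ ≤ L * ‖y - x‖) (x y x' y' : W) :
    ‖F y - F x - (F y' - F x')‖ ≤
      L * ‖y - x - (y' - x')‖ + L * ‖y' - x'‖ * ‖x - x'‖ := by
  obtain ⟨v, rfl⟩ : ∃ v, y' = x' + v := ⟨y' - x', by abel⟩
  obtain ⟨w, rfl⟩ : ∃ w, y = x + w := ⟨y - x, by abel⟩
  simp only [add_sub_cancel_left]
  have h1 := norm_sub_le_of_norm_hasFDerivAt_le hF hL (x + v) (x + w)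
  have hd : ∀ z, HasFDerivAt (fun z => F (z + v) - F z) (F₁ (z + v) - F₁ z) z := fun z =>
    ((hasFDerivAt_comp_add_right v).2 (hF (z + v))).sub (hF z)
  have h2 := norm_sub_le_of_norm_hasFDerivAt_le hd (L := L * ‖v‖) (fun z => by
    simpa using hLip z (z + v)) x' x
  rw [add_sub_add_left_eq_sub] at h1
  have e : F (x + w) - F x - (F (x' + v) - F x') =
      (F (x + w) - F (x + v)) + (F (x + v) - F x - (F (x' + v) - F x')) := by abel
  rw [e]
  exact norm_add_le_of_le h1 h2

/-- Second order four-point estimate. -/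
theorem norm_taylor_sub_le {F : W → E} {F₁ : W → W →L[ℝ] E} {F₂ : W → W →L[ℝ] W →L[ℝ] E} {L : ℝ}
    (hF : ∀ x, HasFDerivAt F (F₁ x) x) (hF₁ : ∀ x, HasFDerivAt F₁ (F₂ x) x)
    (hL : 0 ≤ L) (hL₂ : ∀ x, ‖F₂ x‖ ≤ L)
    (hLip : ∀ x y, ‖F₂ y - F₂ x‖ ≤ L * ‖y - x‖) (x y x' y' : W) :
    ‖F y - F x - F₁ x (y - x) - (F y' - F x' - F₁ x' (y' - x'))‖ ≤
      L * (‖y - x‖ + ‖y' - x'‖) * ‖y - x - (y' - x')‖ + L * ‖y' - x'‖ ^ 2 * ‖x - x'‖ := by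
  obtain ⟨v, rfl⟩ : ∃ v, y' = x' + v := ⟨y' - x', by abel⟩
  obtain ⟨w, rfl⟩ : ∃ w, y = x + w := ⟨y - x, by abel⟩
  simp only [add_sub_cancel_left]
  have hlip₁ := norm_sub_le_of_norm_hasFDerivAt_le hF₁ hL₂
  have h1 : ‖(F (x + w) - F₁ x w) - (F (x + v) - F₁ x v)‖ ≤ L * (‖w‖ + ‖v‖) * ‖w - v‖ := by
    refine (convex_closedBall (0 : W) (‖w‖ + ‖v‖)).norm_image_sub_le_of_norm_hasFDerivWithin_le
      (f := fun z => F (x + z) - F₁ x z) (f' := fun z => F₁ (x + z) - F₁ x) ?_ ?_ ?_ ?_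
    · intro z _
      exact (((hasFDerivAt_comp_add_left x).2 (hF (x + z))).sub
        (F₁ x).hasFDerivAt).hasFDerivWithinAt
    · intro z hz
      have h := hlip₁ x (x + z)
      rw [add_sub_cancel_left] at h
      exact h.trans (mul_le_mul_of_nonneg_left (by simpa using hz) hL)
    · simp
    · simp
  have hd : ∀ z, HasFDerivAt (fun z => F (z + v) - F z - F₁ z v)
      (F₁ (z + v) - F₁ z - (F₂ z).flip v) z := fun z => by
    refine (((hasFDerivAt_comp_add_right v).2 (hF (z + v))).sub (hF z)).sub ?_
    exact ((ContinuousLinearMap.apply ℝ E v).hasFDerivAt.comp z (hF₁ z)).congr_fderiv (by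
      ext; simp)
  have hsym : ∀ z, (F₂ z).flip v = F₂ z v := fun z => by
    ext u
    exact second_derivative_symmetric hF (hF₁ z) u v
  have hbd : ∀ z, ‖F₁ (z + v) - F₁ z - (F₂ z).flip v‖ ≤ L * ‖v‖ ^ 2 := by
    intro z
    rw [hsym]
    have := (convex_closedBall (0 : W) ‖v‖).norm_image_sub_le_of_norm_hasFDerivWithin_le
      (f := fun u => F₁ (z + u) - F₂ z u) (f' := fun u => F₂ (z + u) - F₂ z) (C := L * ‖v‖)
      (x := 0) (y := v) (fun u _ => (((hasFDerivAt_comp_add_left z).2 (hF₁ (z + u))).sub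
        (F₂ z).hasFDerivAt).hasFDerivWithinAt) (fun u hu => by
          have h := hLip z (z + u)
          rw [add_sub_cancel_left] at h
          exact h.trans (mul_le_mul_of_nonneg_left (by simpa using hu) hL)) (by simp) (by simp)
    have e : F₁ (z + v) - F₂ z v - (F₁ (z + 0) - F₂ z 0) = F₁ (z + v) - F₁ z - F₂ z v := by
      rw [add_zero, map_zero]; abel
    rw [e, sub_zero] at this
    exact this.trans (le_of_eq (by ring))
  have h2 := norm_sub_le_of_norm_hasFDerivAt_le hd hbd x' x
  have e : F (x + w) - F x - F₁ x w - (F (x' + v) - F x' - F₁ x' v) =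
      ((F (x + w) - F₁ x w) - (F (x + v) - F₁ x v)) +
        (F (x + v) - F x - F₁ x v - (F (x' + v) - F x' - F₁ x' v)) := by abel
  rw [e]
  exact norm_add_le_of_le h1 h2

/-- `F` has two derivatives `F₁`, `F₂`, all bounded by `L`, and `F₂` is `L`-Lipschitz. -/
structure FunBound (L : ℝ) (F : W → E) (F₁ : W → W →L[ℝ] E) (F₂ : W → W →L[ℝ] W →L[ℝ] E) :
    Prop where
  hasFDerivAt : ∀ x, HasFDerivAt F (F₁ x) x
  hasFDerivAt₁ : ∀ x, HasFDerivAt F₁ (F₂ x) x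
  bound : ∀ x, ‖F x‖ ≤ L
  bound₁ : ∀ x, ‖F₁ x‖ ≤ L
  bound₂ : ∀ x, ‖F₂ x‖ ≤ L
  lip₂ : ∀ x y, ‖F₂ y - F₂ x‖ ≤ L * ‖y - x‖

theorem ContDiff.norm_sub_le_of_norm_iteratedFDeriv_one_le {G : W → E} {C : ℝ}
    (hG : ContDiff ℝ 1 G) (hC : ∀ x, ‖iteratedFDeriv ℝ 1 G x‖ ≤ C) (x y : W) :
    ‖G y - G x‖ ≤ C * ‖y - x‖ :=
  norm_sub_le_of_norm_hasFDerivAt_le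
    (fun x => (hG.differentiable (by norm_num) x).hasFDerivAt) (fun x => by
      have := hC x
      rwa [← norm_iteratedFDeriv_fderiv, norm_iteratedFDeriv_zero] at this) x y

theorem IsCb.exists_funBound {F : W → E} (hF : IsCb 3 F) :
    ∃ L, 0 ≤ L ∧ FunBound L F (fderiv ℝ F) (fderiv ℝ (fderiv ℝ F)) := by
  obtain ⟨hc, hb⟩ := hF
  obtain ⟨C0, h0⟩ := hb 0 (by norm_num)
  obtain ⟨C1, h1⟩ := hb 1 (by norm_num)
  obtain ⟨C2, h2⟩ := hb 2 (by norm_num)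
  obtain ⟨C3, h3⟩ := hb 3 (by norm_num)
  have hc1 : ContDiff ℝ 2 (fderiv ℝ F) := hc.fderiv_right (by norm_num)
  have hc2 : ContDiff ℝ 1 (fderiv ℝ (fderiv ℝ F)) := hc1.fderiv_right (by norm_num)
  have e0 : ∀ x, ‖F x‖ ≤ C0 := fun x => by simpa using h0 x
  have e1 : ∀ x, ‖fderiv ℝ F x‖ ≤ C1 := fun x => by
    have := h1 x
    rwa [← norm_iteratedFDeriv_fderiv, norm_iteratedFDeriv_zero] at this
  have e2 : ∀ x, ‖fderiv ℝ (fderiv ℝ F) x‖ ≤ C2 := fun x => by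
    have := h2 x
    rwa [← norm_iteratedFDeriv_fderiv, ← norm_iteratedFDeriv_fderiv,
      norm_iteratedFDeriv_zero] at this
  have e3 : ∀ x, ‖iteratedFDeriv ℝ 1 (fderiv ℝ (fderiv ℝ F)) x‖ ≤ C3 := fun x => by
    rw [norm_iteratedFDeriv_fderiv, norm_iteratedFDeriv_fderiv]
    exact h3 x
  have p0 := (norm_nonneg (F 0)).trans (e0 0)
  have p1 := (norm_nonneg (fderiv ℝ F 0)).trans (e1 0)
  have p2 := (norm_nonneg (fderiv ℝ (fderiv ℝ F) 0)).trans (e2 0)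
  have p3 := (norm_nonneg (iteratedFDeriv ℝ 3 F 0)).trans (h3 0)
  refine ⟨C0 + C1 + C2 + C3, by positivity,
    fun x => (hc.differentiable (by norm_num) x).hasFDerivAt,
    fun x => (hc1.differentiable (by norm_num) x).hasFDerivAt, fun x => (e0 x).trans ?_,
    fun x => (e1 x).trans ?_, fun x => (e2 x).trans ?_,
    fun x y => (hc2.norm_sub_le_of_norm_iteratedFDeriv_one_le e3 x y).trans
      (mul_le_mul_of_nonneg_right ?_ (norm_nonneg _))⟩ <;>
  linarith

theorem FunBound.mono {F : W → E} {F₁ : W → W →L[ℝ] E} {F₂ : W → W →L[ℝ] W →L[ℝ] E} {L L' : ℝ}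
    (h : FunBound L F F₁ F₂) (hL : L ≤ L') : FunBound L' F F₁ F₂ where
  hasFDerivAt := h.hasFDerivAt
  hasFDerivAt₁ := h.hasFDerivAt₁
  bound x := (h.bound x).trans hL
  bound₁ x := (h.bound₁ x).trans hL
  bound₂ x := (h.bound₂ x).trans hL
  lip₂ x y := (h.lip₂ x y).trans (mul_le_mul_of_nonneg_right hL (norm_nonneg _))

variable {V : Type*} [NormedAddCommGroup V] [NormedSpace ℝ V]
  {α a b e d N L : ℝ} {X : ℝ → V} {Y Yt : ℝ → W} {Y' Yt' : ℝ → V →L[ℝ] W}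
  {F : W → E} {F₁ : W → W →L[ℝ] E} {F₂ : W → W →L[ℝ] W →L[ℝ] E}

theorem norm_comp_le_of_le {V W E : Type*} [NormedAddCommGroup V] [NormedSpace ℝ V]
    [NormedAddCommGroup W] [NormedSpace ℝ W] [NormedAddCommGroup E] [NormedSpace ℝ E]
    {x y : ℝ} {P : W →L[ℝ] E} {B : V →L[ℝ] W} (hP : ‖P‖ ≤ x) (hB : ‖B‖ ≤ y) :
    ‖P.comp B‖ ≤ x * y :=
  (ContinuousLinearMap.opNorm_comp_le _ _).trans
    (mul_le_mul hP hB (norm_nonneg _) ((norm_nonneg P).trans hP))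

/-- Local Lipschitz estimate for the composition of controlled paths with a smooth function. -/
theorem FunBound.ctrlBound_comp_sub (hF : FunBound L F F₁ F₂) (hL : 0 ≤ L) (hN : 0 ≤ N)
    (he : 0 ≤ e) (hd : 0 ≤ d)
    (h : CtrlBound α a b X N N Y Y') (ht : CtrlBound α a b X N N Yt Yt')
    (hs : CtrlBound α a b X e d (fun r => Y r - Yt r) (fun r => Y' r - Yt' r)) :
    CtrlBound α a b X (L * (1 + 3 * N + N ^ 2) * e) (L * (1 + 3 * N + N ^ 2) * (e + d))
      (fun r => F (Y r) - F (Yt r))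
      (fun r => (F₁ (Y r)).comp (Y' r) - (F₁ (Yt r)).comp (Yt' r)) := by
  have lip := norm_sub_le_of_norm_hasFDerivAt_le hF.hasFDerivAt hF.bound₁
  have lip₁ := norm_sub_le_of_norm_hasFDerivAt_le hF.hasFDerivAt₁ hF.bound₂
  have fp := norm_four_point_le hF.hasFDerivAt hF.bound₁ lip₁
  have fp₁ := norm_four_point_le hF.hasFDerivAt₁ hF.bound₂ hF.lip₂
  have ty := norm_taylor_sub_le hF.hasFDerivAt hF.hasFDerivAt₁ hL hF.bound₂ hF.lip₂
  have dF : ∀ s, a ≤ s → s ≤ b → ‖F (Y s) - F (Yt s)‖ ≤ L * e := fun s h1 h2 =>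
    (lip _ _).trans (mul_le_mul_of_nonneg_left (hs.val s h1 h2) hL)
  have dF₁ : ∀ s, a ≤ s → s ≤ b → ‖F₁ (Y s) - F₁ (Yt s)‖ ≤ L * e := fun s h1 h2 =>
    (lip₁ _ _).trans (mul_le_mul_of_nonneg_left (hs.val s h1 h2) hL)
  have eA : ∀ s, (F₁ (Y s)).comp (Y' s) - (F₁ (Yt s)).comp (Yt' s) =
      (F₁ (Y s) - F₁ (Yt s)).comp (Y' s) + (F₁ (Yt s)).comp (Y' s - Yt' s) := fun s => by
    simp only [ContinuousLinearMap.comp_sub, ContinuousLinearMap.sub_comp]; abel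
  refine ⟨⟨?_, ?_⟩, ?_, ?_, ?_⟩
  · intro s t h1 hst h2
    have hw : 0 ≤ (t - s) ^ α := Real.rpow_nonneg (sub_nonneg.2 hst) _
    have h1' := h1.trans hst
    have h2' := hst.trans h2
    have eq : (F₁ (Y t)).comp (Y' t) - (F₁ (Yt t)).comp (Yt' t) -
        ((F₁ (Y s)).comp (Y' s) - (F₁ (Yt s)).comp (Yt' s)) =
        (F₁ (Y t) - F₁ (Y s)).comp (Y' t - Yt' t) +
        (F₁ (Y s)).comp (Y' t - Yt' t - (Y' s - Yt' s)) +
        (F₁ (Y t) - F₁ (Y s) - (F₁ (Yt t) - F₁ (Yt s))).comp (Yt' t) +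
        (F₁ (Y s) - F₁ (Yt s)).comp (Yt' t - Yt' s) := by
      simp only [ContinuousLinearMap.comp_sub, ContinuousLinearMap.sub_comp]; abel
    have i1 := h.incr s t h1 hst h2
    have i2 := ht.incr s t h1 hst h2
    have i3 := hs.incr s t h1 hst h2
    have v := hs.val s h1 h2'
    have c1 : ‖F₁ (Y t) - F₁ (Y s)‖ ≤ L * (N * (t - s) ^ α) :=
      (lip₁ _ _).trans (mul_le_mul_of_nonneg_left i1 hL)
    have c3 : ‖F₁ (Y t) - F₁ (Y s) - (F₁ (Yt t) - F₁ (Yt s))‖ ≤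
        L * (e * (t - s) ^ α) + L * (N * (t - s) ^ α) * e := by
      refine (fp₁ _ _ _ _).trans ?_
      rw [sub_sub_sub_comm (Y t)]
      gcongr
    rw [eq]
    refine (norm_add_le_of_le (norm_add_le_of_le (norm_add_le_of_le
      (norm_comp_le_of_le c1 (hs.deriv_val t h1' h2))
      (norm_comp_le_of_le (hF.bound₁ (Y s)) (hs.deriv s t h1 hst h2)))
      (norm_comp_le_of_le c3 (ht.deriv_val t h1' h2)))
      (norm_comp_le_of_le (dF₁ s h1 h2') (ht.deriv s t h1 hst h2))).trans ?_
    generalize (t - s) ^ α = w at *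
    have e1 : L * (1 + 3 * N + N ^ 2) * (e + d) * w - (L * (N * w) * e + L * (d * w) +
        (L * (e * w) + L * (N * w) * e) * N + L * e * (N * w)) =
        L * e * w + L * (3 * N + N ^ 2) * d * w := by ring
    have : 0 ≤ L * e * w + L * (3 * N + N ^ 2) * d * w := by positivity
    linarith
  · intro s t h1 hst h2
    have hw : 0 ≤ (t - s) ^ α := Real.rpow_nonneg (sub_nonneg.2 hst) _
    have h2' := hst.trans h2
    have eq : Rem X (fun r => F (Y r) - F (Yt r))
        (fun r => (F₁ (Y r)).comp (Y' r) - (F₁ (Yt r)).comp (Yt' r)) s t =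
        (F (Y t) - F (Y s) - F₁ (Y s) (Y t - Y s) -
          (F (Yt t) - F (Yt s) - F₁ (Yt s) (Yt t - Yt s))) +
        (F₁ (Y s) - F₁ (Yt s)) (Rem X Y Y' s t) +
        F₁ (Yt s) (Rem X (fun r => Y r - Yt r) (fun r => Y' r - Yt' r) s t) := by
      simp only [Rem, map_sub, sub_apply, ContinuousLinearMap.comp_apply]
      abel
    have i1 := h.incr s t h1 hst h2
    have i2 := ht.incr s t h1 hst h2
    have i3 := hs.incr s t h1 hst h2
    have v := hs.val s h1 h2'
    have c1 : ‖F (Y t) - F (Y s) - F₁ (Y s) (Y t - Y s) -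
        (F (Yt t) - F (Yt s) - F₁ (Yt s) (Yt t - Yt s))‖ ≤
        L * (N * (t - s) ^ α + N * (t - s) ^ α) * (e * (t - s) ^ α) +
          L * (N * (t - s) ^ α) ^ 2 * e := by
      refine (ty _ _ _ _).trans ?_
      rw [sub_sub_sub_comm (Y t)]
      gcongr
    rw [eq]
    refine (norm_add_le_of_le (norm_add_le_of_le c1
      (ContinuousLinearMap.le_of_opNorm_le_of_le _ (dF₁ s h1 h2') (h.rem s t h1 hst h2)))
      (ContinuousLinearMap.le_of_opNorm_le_of_le _ (hF.bound₁ (Yt s))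
        (hs.rem s t h1 hst h2))).trans ?_
    generalize (t - s) ^ α = w at *
    have e1 : L * (1 + 3 * N + N ^ 2) * (e + d) * w ^ 2 -
        (L * (N * w + N * w) * (e * w) + L * (N * w) ^ 2 * e + L * e * (N * w ^ 2) +
          L * (d * w ^ 2)) = (L * e + L * (3 * N + N ^ 2) * d) * w ^ 2 := by ring
    have : 0 ≤ (L * e + L * (3 * N + N ^ 2) * d) * w ^ 2 := by positivity
    linarith
  · intro s h1 h2
    refine (dF s h1 h2).trans ?_
    have : 0 ≤ L * (3 * N + N ^ 2) * e := by positivity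
    linarith
  · intro s h1 h2
    rw [eA]
    refine (norm_add_le_of_le (norm_comp_le_of_le (dF₁ s h1 h2) (h.deriv_val s h1 h2))
      (norm_comp_le_of_le (hF.bound₁ (Yt s)) (hs.deriv_val s h1 h2))).trans ?_
    have : 0 ≤ L * (2 * N + N ^ 2) * e := by positivity
    linarith
  · intro s t h1 hst h2
    have hw : 0 ≤ (t - s) ^ α := Real.rpow_nonneg (sub_nonneg.2 hst) _
    have i2 := ht.incr s t h1 hst h2
    have i3 := hs.incr s t h1 hst h2
    have v := hs.val s h1 (hst.trans h2)
    have c1 : ‖F (Y t) - F (Y s) - (F (Yt t) - F (Yt s))‖ ≤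
        L * (e * (t - s) ^ α) + L * (N * (t - s) ^ α) * e := by
      refine (fp _ _ _ _).trans ?_
      rw [sub_sub_sub_comm (Y t)]
      gcongr
    rw [sub_sub_sub_comm]
    refine c1.trans ?_
    generalize (t - s) ^ α = w at *
    have : 0 ≤ L * (2 * N + N ^ 2) * e * w := by positivity
    linarith

end Composition

section RoughEquation

variable {V V2 W U : Type*}
  [NormedAddCommGroup V] [NormedSpace ℝ V] [NormedAddCommGroup V2] [NormedSpace ℝ V2]
  [NormedAddCommGroup W] [NormedSpace ℝ W] [NormedAddCommGroup U] [NormedSpace ℝ U]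

theorem HBound.exists_nonneg {E : Type*} [NormedAddCommGroup E] {T β : ℝ} {A : ℝ → ℝ → E}
    (h : HBound T β A) (h0 : ∀ s, 0 ≤ s → s ≤ T → A s s = 0) :
    ∃ C, 0 ≤ C ∧ ∀ s t, 0 ≤ s → s ≤ t → t ≤ T → ‖A s t‖ ≤ C * (t - s) ^ β := by
  obtain ⟨C, hC⟩ := h
  refine ⟨|C|, abs_nonneg C, fun s t hs hst ht => ?_⟩
  have hw := Real.rpow_nonneg (sub_nonneg.2 hst) β
  rcases hst.eq_or_lt with rfl | hst
  · rw [h0 s hs ht, norm_zero]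
    positivity
  · exact (hC s t hs hst ht).trans (mul_le_mul_of_nonneg_right (le_abs_self C) hw)

theorem rpow_two_mul {x : ℝ} (hx : 0 ≤ x) (α : ℝ) : x ^ (2 * α) = (x ^ α) ^ 2 := by
  rw [mul_comm, Real.rpow_mul hx]; norm_cast

theorem IsCRP.exists_ctrlSeminormLE {T α : ℝ} {X : ℝ → V} {Y : ℝ → W} {Y' : ℝ → V →L[ℝ] W}
    (h : IsCRP T α X Y Y') : ∃ d, 0 ≤ d ∧ CtrlSeminormLE α 0 T X d Y Y' := by
  obtain ⟨C, hC, h1⟩ := h.deriv_hold.exists_nonneg (fun s _ _ => sub_self _)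
  obtain ⟨D, hD, h2⟩ := h.rem_hold.exists_nonneg (fun s _ _ => by simp [Rem])
  refine ⟨C + D, add_nonneg hC hD, fun s t hs hst ht => (h1 s t hs hst ht).trans ?_,
    fun s t hs hst ht => (h2 s t hs hst ht).trans ?_⟩
  · exact mul_le_mul_of_nonneg_right (by linarith) (Real.rpow_nonneg (sub_nonneg.2 hst) _)
  · rw [rpow_two_mul (sub_nonneg.2 hst)]
    exact mul_le_mul_of_nonneg_right (by linarith) (by positivity)

theorem CtrlSeminormLE.isCRP {T α d : ℝ} {X : ℝ → V} {Y : ℝ → W} {Y' : ℝ → V →L[ℝ] W}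
    (h : CtrlSeminormLE α 0 T X d Y Y') : IsCRP T α X Y Y' where
  deriv_hold := ⟨d, fun s t hs hst ht => h.deriv s t hs hst.le ht⟩
  rem_hold := ⟨d, fun s t hs hst ht => by
    rw [rpow_two_mul (sub_nonneg.2 hst.le)]
    exact h.rem s t hs hst.le ht⟩

variable {T α L M N a b d e : ℝ} {tops : TensorOps V V2 U W} {X : ℝ → V} {XX : ℝ → ℝ → V2}
  {Z : ℝ → U} {Z' : ℝ → V →L[ℝ] U} {F : W → U →L[ℝ] W} {F₁ : W → W →L[ℝ] (U →L[ℝ] W)}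
  {F₂ : W → W →L[ℝ] W →L[ℝ] (U →L[ℝ] W)}
  {Y Yt Q Qt : ℝ → W} {Y' Yt' Q' Qt' : ℝ → V →L[ℝ] W}

theorem DriverBound.mono {L' : ℝ} (h : DriverBound T α L tops X XX Z Z') (hL : L ≤ L') :
    DriverBound T α L' tops X XX Z Z' where
  chen := h.chen
  path s t hs hst ht := (h.path s t hs hst ht).trans
    (mul_le_mul_of_nonneg_right hL (Real.rpow_nonneg (sub_nonneg.2 hst) _))
  area s t hs hst ht := (h.area s t hs hst ht).trans
    (mul_le_mul_of_nonneg_right hL (by positivity))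
  ctrl := h.ctrl.mono hL hL

theorem exists_driverBound (hα : 0 < α) (hX : IsRoughPath T α tops.tmul X XX)
    (hZ : IsCRP T α X Z Z') {S : ℝ} (hS : S ≤ T) (hS1 : S ≤ 1) (hS0 : 0 ≤ S) :
    ∃ L, 0 ≤ L ∧ DriverBound S α L tops X XX Z Z' := by
  obtain ⟨C, hC, h1⟩ := hX.x_hold.exists_nonneg (fun s _ _ => sub_self _)
  obtain ⟨D, hD, h2⟩ := hX.xx_hold.exists_nonneg (fun s hs hsT => by
    simpa using hX.chen s s s hs le_rfl le_rfl hsT)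
  obtain ⟨d, hd, h3⟩ := hZ.exists_ctrlSeminormLE
  have hM : 0 ≤ ‖Z 0‖ + ‖Z' 0‖ := by positivity
  have hη := Real.rpow_nonneg (sub_nonneg.2 hS0) α
  have h4 : CtrlSeminormLE α 0 S X d Z Z' :=
    ⟨fun s t hs hst ht => h3.deriv s t hs hst (ht.trans hS),
      fun s t hs hst ht => h3.rem s t hs hst (ht.trans hS)⟩
  have h5 := h4.ctrlBound (M := ‖Z 0‖ + ‖Z' 0‖) hα hC hM hd (by linarith)
    (fun s t hs hst ht => h1 s t hs hst (ht.trans hS)) (by simp) (by simp)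
  generalize he : (‖Z 0‖ + ‖Z' 0‖ + d * (S - 0) ^ α) * (1 + C) = e at h5
  have he0 : 0 ≤ e := he ▸ by positivity
  refine ⟨C + D + d + e, by positivity, ?_⟩
  exact
    { chen := fun s u t hs hsu hut ht => hX.chen s u t hs hsu hut (ht.trans hS)
      path := fun s t hs hst ht => (h1 s t hs hst (ht.trans hS)).trans
        (mul_le_mul_of_nonneg_right (by linarith) (Real.rpow_nonneg (sub_nonneg.2 hst) _))
      area := fun s t hs hst ht => (h2 s t hs hst (ht.trans hS)).trans (by
        rw [rpow_two_mul (sub_nonneg.2 hst)]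
        exact mul_le_mul_of_nonneg_right (by linarith) (by positivity))
      ctrl := h5.mono (by linarith) (by linarith) }

/-- A controlled path starting at zero is bounded by its seminorm. -/
theorem CtrlSeminormLE.norm_le_of_eq_zero {E : Type*} [NormedAddCommGroup E] [NormedSpace ℝ E]
    {Y : ℝ → E} {Y' : ℝ → V →L[ℝ] E} (hα : 0 < α) (hL : 0 ≤ L) (hd : 0 ≤ d) (hab : b - a ≤ 1)
    (hX : ∀ s t, a ≤ s → s ≤ t → t ≤ b → ‖X t - X s‖ ≤ L * (t - s) ^ α)
    (h : CtrlSeminormLE α a b X d Y Y') (h0 : Y a = 0) (h0' : Y' a = 0) {t : ℝ} (h1 : a ≤ t)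
    (h2 : t ≤ b) : ‖Y t‖ ≤ (1 + L) * d ∧ ‖Y' t‖ ≤ (1 + L) * d := by
  have hη1 : (b - a) ^ α ≤ 1 := Real.rpow_le_one (sub_nonneg.2 (h1.trans h2)) hab hα.le
  have hb := h.ctrlBound (M := 0) hα hL le_rfl hd hab hX (by simp [h0]) (by simp [h0'])
  have hle : (0 + d * (b - a) ^ α) * (1 + L) ≤ (1 + L) * d := by
    have : d * (b - a) ^ α ≤ d * 1 := mul_le_mul_of_nonneg_left hη1 hd
    nlinarith
  exact ⟨(hb.val t h1 h2).trans hle, (hb.deriv_val t h1 h2).trans hle⟩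

/-- `(Q, Q')` is, up to its initial value, the rough integral of `(F(Y), F₁(Y) ∘ Y')` against
`(Z, Z')` on `[a,b]`. -/
structure IsPicardImage (α a b : ℝ) (tops : TensorOps V V2 U W) (XX : ℝ → ℝ → V2)
    (Z : ℝ → U) (Z' : ℝ → V →L[ℝ] U) (F : W → U →L[ℝ] W) (F₁ : W → W →L[ℝ] (U →L[ℝ] W))
    (Y : ℝ → W) (Y' : ℝ → V →L[ℝ] W) (Q : ℝ → W) (Q' : ℝ → V →L[ℝ] W) : Prop where
  deriv_eq : ∀ t, a ≤ t → t ≤ b → Q' t = (F (Y t)).comp (Z' t)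
  germ_le : ∃ K, ∀ s t, a ≤ s → s ≤ t → t ≤ b →
    ‖Q t - Q s - germ tops XX Z Z' (fun r => F (Y r)) (fun r => (F₁ (Y r)).comp (Y' r)) s t‖ ≤
      K * (t - s) ^ (3 * α)

theorem IsPicardImage.restrict {a' b' : ℝ}
    (h : IsPicardImage α a b tops XX Z Z' F F₁ Y Y' Q Q') (ha : a ≤ a') (hb : b' ≤ b) :
    IsPicardImage α a' b' tops XX Z Z' F F₁ Y Y' Q Q' where
  deriv_eq t h1 h2 := h.deriv_eq t (ha.trans h1) (h2.trans hb)
  germ_le := h.germ_le.imp fun _ hK s t hs hst ht => hK s t (ha.trans hs) hst (ht.trans hb)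

theorem IsPicardImage.congr (h : IsPicardImage α a b tops XX Z Z' F F₁ Y Y' Q Q')
    (h1 : ∀ t, a ≤ t → t ≤ b → Qt t = Q t) (h2 : ∀ t, a ≤ t → t ≤ b → Qt' t = Q' t) :
    IsPicardImage α a b tops XX Z Z' F F₁ Y Y' Qt Qt' where
  deriv_eq t ha hb := (h2 t ha hb).trans (h.deriv_eq t ha hb)
  germ_le := h.germ_le.imp fun _ hK s t hs hst ht => by
    rw [h1 s hs (hst.trans ht), h1 t (hs.trans hst) ht]
    exact hK s t hs hst ht

/-- The Lipschitz constant of the Picard map, up to the factor `(b - a) ^ α`. -/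
noncomputable def picardConst (α L N : ℝ) : ℝ :=
  integralConst α L * (L * (1 + 3 * N + N ^ 2)) * (3 + 2 * L)

theorem picardConst_nonneg (hα : 1 / 3 < α) (hL : 0 ≤ L) (hN : 0 ≤ N) :
    0 ≤ picardConst α L N := by
  have := integralConst_nonneg hα hL
  unfold picardConst
  positivity

theorem DriverBound.ctrlSeminormLE_picard_sub (hD : DriverBound T α L tops X XX Z Z')
    (hF : FunBound L F F₁ F₂) (hα : 1 / 3 < α) (hL : 0 ≤ L) (hN : 0 ≤ N) (hd : 0 ≤ d)
    (ha : 0 ≤ a) (hb : b ≤ T) (hab : a ≤ b) (hab1 : b - a ≤ 1)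
    (h : CtrlBound α a b X N N Y Y') (ht : CtrlBound α a b X N N Yt Yt')
    (h0 : Y a = Yt a) (h0' : Y' a = Yt' a)
    (hs : CtrlSeminormLE α a b X d (fun r => Y r - Yt r) (fun r => Y' r - Yt' r))
    (hQ : IsPicardImage α a b tops XX Z Z' F F₁ Y Y' Q Q')
    (hQt : IsPicardImage α a b tops XX Z Z' F F₁ Yt Yt' Qt Qt') :
    CtrlSeminormLE α a b X (picardConst α L N * (b - a) ^ α * d)
      (fun r => Q r - Qt r) (fun r => Q' r - Qt' r) := by
  have hα0 : 0 < α := by linarith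
  have hη0 : 0 ≤ (b - a) ^ α := Real.rpow_nonneg (sub_nonneg.2 hab) _
  have hη1 : (b - a) ^ α ≤ 1 := Real.rpow_le_one (sub_nonneg.2 hab) hab1 hα0.le
  have hX : ∀ s t, a ≤ s → s ≤ t → t ≤ b → ‖X t - X s‖ ≤ L * (t - s) ^ α :=
    fun s t h1 h2 h3 => hD.path s t (ha.trans h1) h2 (h3.trans hb)
  have hI := integralConst_nonneg hα hL
  have hc := hF.ctrlBound_comp_sub hL hN (e := (0 + d * (b - a) ^ α) * (1 + L)) (by positivity)
    hd h ht (hs.ctrlBound hα0 hL le_rfl hd hab1 hX (by simp [h0]) (by simp [h0']))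
  obtain ⟨K, hK⟩ := hQ.germ_le
  obtain ⟨Kt, hKt⟩ := hQt.germ_le
  have := hD.ctrlSeminormLE_integral hα hL (by positivity) (by positivity) hc ha hb hab1
    (Q := fun r => Q r - Qt r) (K := K + Kt) (fun s t h1 h2 h3 => by
      rw [germ_sub, sub_sub_sub_comm (Q t), sub_sub_sub_comm (Q t - Q s), add_mul]
      exact norm_sub_le_of_le (hK s t h1 h2 h3) (hKt s t h1 h2 h3))
  refine (this.congr (fun _ _ _ => rfl) fun t h1 h2 => ?_).mono ?_
  · rw [hQ.deriv_eq t h1 h2, hQt.deriv_eq t h1 h2, ContinuousLinearMap.sub_comp]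
  · unfold picardConst
    generalize (b - a) ^ α = η at *
    have hC : 0 ≤ integralConst α L * (L * (1 + 3 * N + N ^ 2)) := by positivity
    have e1 : integralConst α L * (L * (1 + 3 * N + N ^ 2) * ((0 + d * η) * (1 + L)) +
        L * (1 + 3 * N + N ^ 2) * ((0 + d * η) * (1 + L) + d) * η) =
        integralConst α L * (L * (1 + 3 * N + N ^ 2)) * ((2 + L + η * (1 + L)) * (η * d)) := by ring
    rw [e1, mul_assoc (integralConst α L * (L * (1 + 3 * N + N ^ 2)) * (3 + 2 * L)),
      mul_assoc (integralConst α L * (L * (1 + 3 * N + N ^ 2)))]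
    refine mul_le_mul_of_nonneg_left (mul_le_mul_of_nonneg_right ?_ (by positivity)) hC
    nlinarith [mul_le_mul_of_nonneg_right hη1 (by linarith : (0 : ℝ) ≤ 1 + L)]

theorem FunBound.ctrlBound_comp (hF : FunBound L F F₁ F₂) (hL : 0 ≤ L) (hN : 0 ≤ N)
    (h : CtrlBound α a b X e d Y Y') (he : e ≤ N) (hd : d ≤ N) :
    CtrlBound α a b X (L * (1 + e)) (L * (1 + 3 * N + N ^ 2) * (2 * N))
      (fun r => F (Y r)) (fun r => (F₁ (Y r)).comp (Y' r)) := by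
  have h0 : CtrlBound α a b X N N (fun _ => (0 : W)) (fun _ => (0 : V →L[ℝ] W)) := by
    have hw : ∀ s t : ℝ, s ≤ t → 0 ≤ (t - s) ^ α := fun s t hst =>
      Real.rpow_nonneg (sub_nonneg.2 hst) _
    refine ⟨⟨fun s t _ hst _ => ?_, fun s t _ hst _ => ?_⟩, fun _ _ _ => by simpa,
      fun _ _ _ => by simpa, fun s t _ hst _ => ?_⟩ <;>
    · have := hw s t hst
      simp only [Rem, sub_self, zero_apply, norm_zero]
      positivity
  have hc := hF.ctrlBound_comp_sub hL hN hN hN (h.mono he hd) h0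
    ((h.mono he hd).restrict le_rfl le_rfl |> fun h => by simpa using h)
  have lip := norm_sub_le_of_norm_hasFDerivAt_le hF.hasFDerivAt hF.bound₁
  refine ⟨⟨fun s t hs hst ht => ?_, fun s t hs hst ht => ?_⟩, fun s h1 h2 => ?_,
    fun s h1 h2 => ?_, fun s t hs hst ht => ?_⟩
  · have := hc.deriv s t hs hst ht
    simpa [two_mul] using this
  · have := hc.rem s t hs hst ht
    simpa [two_mul, Rem] using this
  · have : 0 ≤ L * e := mul_nonneg hL ((norm_nonneg _).trans (h.val s h1 h2))
    linarith [hF.bound (Y s)]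
  · have := norm_comp_le_of_le (hF.bound₁ (Y s)) (h.deriv_val s h1 h2)
    linarith
  · have hw : 0 ≤ (t - s) ^ α := Real.rpow_nonneg (sub_nonneg.2 hst) _
    refine (lip _ _).trans ?_
    have h1 := mul_le_mul_of_nonneg_left (h.incr s t hs hst ht) hL
    have h2 : 0 ≤ L * (t - s) ^ α := mul_nonneg hL hw
    linarith

theorem DriverBound.exists_isPicardImage [CompleteSpace W]
    (hD : DriverBound T α L tops X XX Z Z') (hF : FunBound L F F₁ F₂) (hα : 1 / 3 < α)
    (hL : 0 ≤ L) (hN : 0 ≤ N) (ha : 0 ≤ a) (hb : b ≤ T) (h : CtrlBound α a b X N N Y Y') (w : W) :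
    ∃ Q Q', Q a = w ∧ IsPicardImage α a b tops XX Z Z' F F₁ Y Y' Q Q' := by
  have hc := hF.ctrlBound_comp hL hN h le_rfl le_rfl
  obtain ⟨I, hI, hI'⟩ := exists_sewing (by linarith)
    (hD.norm_germ_defect_le (by linarith) hL (by positivity) (by positivity) hc ha hb)
  refine ⟨fun t => w + I t, fun t => (F (Y t)).comp (Z' t), by simp [hI], fun _ _ _ => rfl, ?K,
    fun s t hs hst ht => ?h⟩
  case h =>
    rw [add_sub_add_left_eq_sub]
    exact hI' s t hs hst ht

/-- Short time intervals make a ball of controlled paths invariant under the Picard map. -/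
theorem DriverBound.ctrlSeminormLE_picard (hD : DriverBound T α L tops X XX Z Z')
    (hF : FunBound L F F₁ F₂) (hα : 1 / 3 < α) (hL : 0 ≤ L) (hM : 0 ≤ M)
    (ha : 0 ≤ a) (hb : b ≤ T) (hab1 : b - a ≤ 1)
    (h : CtrlBound α a b X e d Y Y') (he : 0 ≤ e) (heM : e ≤ M) (hdM : d ≤ M)
    (hη : L * (1 + 3 * M + M ^ 2) * (2 * M) * (b - a) ^ α ≤ 1)
    (hQ : IsPicardImage α a b tops XX Z Z' F F₁ Y Y' Q Q') :
    CtrlSeminormLE α a b X (integralConst α L * (L * (1 + e) + 1)) Q Q' := by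
  obtain ⟨K, hK⟩ := hQ.germ_le
  refine ((hD.ctrlSeminormLE_integral hα hL (by positivity) (by positivity)
    (hF.ctrlBound_comp hL hM h heM hdM) ha hb hab1 hK).congr (fun _ _ _ => rfl)
    hQ.deriv_eq).mono ?_
  exact mul_le_mul_of_nonneg_left (by linarith) (integralConst_nonneg hα hL)

/-- Picard iteration for a relation on controlled paths which halves the distance. -/
theorem exists_picard_limit [CompleteSpace W] (hα : 0 < α) (hL : 0 ≤ L) (hN : 0 ≤ N)
    (hab : a ≤ b) (hab1 : b - a ≤ 1)
    (hX : ∀ s t, a ≤ s → s ≤ t → t ≤ b → ‖X t - X s‖ ≤ L * (t - s) ^ α) (w : W) (w' : V →L[ℝ] W)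
    {S : Set ((ℝ → W) × (ℝ → V →L[ℝ] W))}
    (hS : ∀ p, p ∈ S ↔ CtrlSeminormLE α a b X N p.1 p.2 ∧ p.1 a = w ∧ p.2 a = w')
    {R : (ℝ → W) × (ℝ → V →L[ℝ] W) → (ℝ → W) × (ℝ → V →L[ℝ] W) → Prop}
    (hR : ∀ p ∈ S, ∃ q ∈ S, R p q)
    (hc : ∀ p ∈ S, ∀ pt ∈ S, ∀ q qt, R p q → R pt qt → ∀ d, 0 ≤ d →
      CtrlSeminormLE α a b X d (fun r => p.1 r - pt.1 r) (fun r => p.2 r - pt.2 r) →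
      CtrlSeminormLE α a b X (d / 2) (fun r => q.1 r - qt.1 r) (fun r => q.2 r - qt.2 r)) :
    ∃ p ∈ S, ∃ q ∈ S, R p q ∧ ∀ t, a ≤ t → t ≤ b → p.1 t = q.1 t ∧ p.2 t = q.2 t := by
  choose! f hfS hfR using hR
  obtain ⟨p₀, hp₀⟩ : ∃ p, p ∈ S := by
    refine ⟨(fun t => w + w' (X t - X a), fun _ => w'), (hS _).2 ⟨⟨?_, ?_⟩, by simp, rfl⟩⟩ <;>
    · intro s t _ hst _
      have hw : 0 ≤ (t - s) ^ α := Real.rpow_nonneg (sub_nonneg.2 hst) _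
      simp only [Rem, add_sub_add_left_eq_sub, ← map_sub, sub_sub_sub_cancel_right, sub_self,
        norm_zero]
      positivity
  have hpS : ∀ n, f^[n] p₀ ∈ S := fun n => by
    induction n with
    | zero => exact hp₀
    | succ n ih => rw [Function.iterate_succ_apply']; exact hfS _ ih
  have small : ∀ p ∈ S, ∀ q ∈ S, ∀ d, 0 ≤ d →
      CtrlSeminormLE α a b X d (fun r => p.1 r - q.1 r) (fun r => p.2 r - q.2 r) →
      ∀ t, a ≤ t → t ≤ b → ‖p.1 t - q.1 t‖ ≤ (1 + L) * d ∧ ‖p.2 t - q.2 t‖ ≤ (1 + L) * d := by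
    intro p hp q hq d hd h t h1 h2
    obtain ⟨-, hp, hp'⟩ := (hS _).1 hp
    obtain ⟨-, hq, hq'⟩ := (hS _).1 hq
    exact h.norm_le_of_eq_zero hα hL hd hab1 hX (by simp [hp, hq]) (by simp [hp', hq']) h1 h2
  have hdiff : ∀ n, CtrlSeminormLE α a b X (2 * N / 2 ^ n)
      (fun r => (f^[n] p₀).1 r - (f^[n + 1] p₀).1 r)
      (fun r => (f^[n] p₀).2 r - (f^[n + 1] p₀).2 r) := fun n => by
    induction n with
    | zero =>
      exact (((hS _).1 (hpS 0)).1.sub ((hS _).1 (hpS 1)).1).mono (by simp [two_mul])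
    | succ n ih =>
      have := hc _ (hpS n) _ (hpS (n + 1)) _ _ (hfR _ (hpS n)) (hfR _ (hpS (n + 1))) _
        (by positivity) ih
      rw [← Function.iterate_succ_apply' f, ← Function.iterate_succ_apply' f] at this
      exact this.mono (le_of_eq (by rw [pow_succ]; field_simp))
  have hdiff' : ∀ n k, CtrlSeminormLE α a b X (4 * N / 2 ^ n - 4 * N / 2 ^ (n + k))
      (fun r => (f^[n] p₀).1 r - (f^[n + k] p₀).1 r)
      (fun r => (f^[n] p₀).2 r - (f^[n + k] p₀).2 r) := fun n k => by
    induction k with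
    | zero => constructor <;> simp [Rem]
    | succ k ih =>
      refine ((ih.add (hdiff (n + k))).congr (fun t _ _ => by simp [add_assoc])
        (fun t _ _ => by simp [add_assoc])).mono (le_of_eq ?_)
      rw [← add_assoc, pow_succ (2 : ℝ) (n + k)]
      field_simp
      ring
  have cauchy : ∀ t, a ≤ t → t ≤ b → CauchySeq (fun n => (f^[n] p₀).1 t) ∧
      CauchySeq (fun n => (f^[n] p₀).2 t) := fun t h1 h2 => by
    have hle := fun n => small _ (hpS n) _ (hpS (n + 1)) _ (by positivity) (hdiff n) t h1 h2
    constructor <;> refine cauchySeq_of_le_geometric_two (C := (1 + L) * (4 * N)) fun n => ?_ <;>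
      rw [dist_eq_norm]
    · exact (hle n).1.trans (le_of_eq (by ring))
    · exact (hle n).2.trans (le_of_eq (by ring))
  have hlim : ∀ t, ∃ y, a ≤ t → t ≤ b →
      Filter.Tendsto (fun n => (f^[n] p₀).1 t) Filter.atTop (nhds y) := fun t => by
    by_cases h : a ≤ t ∧ t ≤ b
    · exact (cauchySeq_tendsto_of_complete (cauchy t h.1 h.2).1).imp fun _ hy _ _ => hy
    · exact ⟨0, fun h1 h2 => absurd ⟨h1, h2⟩ h⟩
  have hlim' : ∀ t, ∃ y, a ≤ t → t ≤ b →
      Filter.Tendsto (fun n => (f^[n] p₀).2 t) Filter.atTop (nhds y) := fun t => by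
    by_cases h : a ≤ t ∧ t ≤ b
    · exact (cauchySeq_tendsto_of_complete (cauchy t h.1 h.2).2).imp fun _ hy _ _ => hy
    · exact ⟨0, fun h1 h2 => absurd ⟨h1, h2⟩ h⟩
  choose Y hY using hlim
  choose Y' hY' using hlim'
  have hYS : (Y, Y') ∈ S := by
    refine (hS _).2 ⟨CtrlSeminormLE.of_tendsto
      (Filter.Eventually.of_forall fun n => ((hS _).1 (hpS n)).1) hY hY', ?_, ?_⟩
    · refine tendsto_nhds_unique (hY a le_rfl hab) ?_
      simp only [fun n => ((hS _).1 (hpS n)).2.1]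
      exact tendsto_const_nhds
    · refine tendsto_nhds_unique (hY' a le_rfl hab) ?_
      simp only [fun n => ((hS _).1 (hpS n)).2.2]
      exact tendsto_const_nhds
  have hlimdiff : ∀ n, CtrlSeminormLE α a b X (4 * N / 2 ^ n)
      (fun r => (f^[n] p₀).1 r - Y r) (fun r => (f^[n] p₀).2 r - Y' r) := fun n => by
    have hsh : Filter.Tendsto (fun k => n + k) Filter.atTop Filter.atTop :=
      Filter.tendsto_atTop_mono (fun k => Nat.le_add_left k n) Filter.tendsto_id
    refine CtrlSeminormLE.of_tendsto (Filter.Eventually.of_forall fun k =>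
      (hdiff' n k).mono (sub_le_self _ (by positivity)))
      (fun t h1 h2 => tendsto_const_nhds.sub ((hY t h1 h2).comp hsh))
      (fun t h1 h2 => tendsto_const_nhds.sub ((hY' t h1 h2).comp hsh))
  refine ⟨(Y, Y'), hYS, f (Y, Y'), hfS _ hYS, hfR _ hYS, fun t h1 h2 => ?_⟩
  have hle : ∀ n, ‖(f^[n + 1] p₀).1 t - (f (Y, Y')).1 t‖ ≤ (1 + L) * (4 * N / 2 ^ n / 2) ∧
      ‖(f^[n + 1] p₀).2 t - (f (Y, Y')).2 t‖ ≤ (1 + L) * (4 * N / 2 ^ n / 2) := fun n => by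
    have := hc _ (hpS n) _ hYS _ _ (hfR _ (hpS n)) (hfR _ hYS) _ (by positivity) (hlimdiff n)
    rw [← Function.iterate_succ_apply' f n p₀] at this
    exact small _ (hpS (n + 1)) _ (hfS _ hYS) _ (by positivity) this t h1 h2
  have h0 : Filter.Tendsto (fun n : ℕ => (1 + L) * (4 * N / 2 ^ n / 2)) Filter.atTop (nhds 0) := by
    have := (tendsto_pow_atTop_nhds_zero_of_lt_one (r := (1 / 2 : ℝ)) (by norm_num)
      (by norm_num)).const_mul ((1 + L) * (2 * N))
    rw [mul_zero] at this
    refine this.congr fun n => ?_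
    rw [one_div, inv_pow]
    ring
  constructor
  · exact tendsto_nhds_unique ((hY t h1 h2).comp (Filter.tendsto_add_atTop_nat 1))
      (tendsto_iff_norm_sub_tendsto_zero.2 (squeeze_zero (fun _ => norm_nonneg _)
        (fun n => (hle n).1) h0))
  · exact tendsto_nhds_unique ((hY' t h1 h2).comp (Filter.tendsto_add_atTop_nat 1))
      (tendsto_iff_norm_sub_tendsto_zero.2 (squeeze_zero (fun _ => norm_nonneg _)
        (fun n => (hle n).2) h0))

theorem eq_of_forall_dist_le_div_two_pow {E : Type*} [NormedAddCommGroup E] {x y : E} {C : ℝ}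
    (h : ∀ n : ℕ, ‖x - y‖ ≤ C / 2 ^ n) : x = y := by
  have h0 : Filter.Tendsto (fun n : ℕ => C / 2 ^ n) Filter.atTop (nhds 0) := by
    have := (tendsto_pow_atTop_nhds_zero_of_lt_one (r := (1 / 2 : ℝ)) (by norm_num)
      (by norm_num)).const_mul C
    rw [mul_zero] at this
    refine this.congr fun n => ?_
    rw [one_div, inv_pow]
    rfl
  exact sub_eq_zero.1 (norm_le_zero_iff.1 (ge_of_tendsto' h0 h))

theorem exists_pos_mul_rpow_le_half {S B α : ℝ} (hS : 0 < S) (hB : 0 ≤ B) (hα : 0 < α) :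
    ∃ τ, 0 < τ ∧ τ ≤ S ∧ ∀ x, 0 ≤ x → x ≤ τ → B * x ^ α ≤ 1 / 2 := by
  have hc : 0 < 1 / (2 * (B + 1)) := by positivity
  refine ⟨min S ((1 / (2 * (B + 1))) ^ (1 / α)), lt_min hS (Real.rpow_pos_of_pos hc _),
    min_le_left _ _, fun x h0 hx => ?_⟩
  have h1 : x ^ α ≤ 1 / (2 * (B + 1)) := by
    refine (Real.rpow_le_rpow h0 (hx.trans (min_le_right _ _)) hα.le).trans ?_
    rw [← Real.rpow_mul hc.le, one_div_mul_cancel hα.ne', Real.rpow_one]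
  refine (mul_le_mul_of_nonneg_left h1 hB).trans ?_
  rw [mul_one_div, div_le_div_iff₀ (by positivity) (by norm_num)]
  linarith

theorem DriverBound.eqOn_of_isPicardImage_self (hD : DriverBound T α L tops X XX Z Z')
    (hF : FunBound L F F₁ F₂) (hα : 1 / 3 < α) (hL : 0 ≤ L) (hN : 0 ≤ N)
    (ha : 0 ≤ a) (hb : b ≤ T) (hab : a ≤ b) (hab1 : b - a ≤ 1)
    (hη : picardConst α L N * (b - a) ^ α ≤ 1 / 2)
    (h : CtrlBound α a b X N N Y Y') (ht : CtrlBound α a b X N N Yt Yt')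
    (h0 : Y a = Yt a) (h0' : Y' a = Yt' a)
    (hQ : IsPicardImage α a b tops XX Z Z' F F₁ Y Y' Y Y')
    (hQt : IsPicardImage α a b tops XX Z Z' F F₁ Yt Yt' Yt Yt') {t : ℝ} (h1 : a ≤ t)
    (h2 : t ≤ b) : Y t = Yt t ∧ Y' t = Yt' t := by
  have hs : ∀ n : ℕ, CtrlSeminormLE α a b X (2 * N / 2 ^ n)
      (fun r => Y r - Yt r) (fun r => Y' r - Yt' r) := fun n => by
    induction n with
    | zero => exact (h.toCtrlSeminormLE.sub ht.toCtrlSeminormLE).mono (by simp [two_mul])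
    | succ n ih =>
      refine (hD.ctrlSeminormLE_picard_sub hF hα hL hN (by positivity) ha hb hab hab1 h ht h0 h0'
        ih hQ hQt).mono ?_
      refine (mul_le_mul_of_nonneg_right hη (by positivity)).trans (le_of_eq ?_)
      rw [pow_succ]
      field_simp
  have hle := fun n => (hs n).norm_le_of_eq_zero (by linarith) hL (by positivity) hab1
    (fun s t h1 h2 h3 => hD.path s t (ha.trans h1) h2 (h3.trans hb)) (by simp [h0])
    (by simp [h0']) h1 h2
  exact ⟨eq_of_forall_dist_le_div_two_pow (C := (1 + L) * (2 * N)) fun n =>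
      (hle n).1.trans (le_of_eq (by ring)),
    eq_of_forall_dist_le_div_two_pow (C := (1 + L) * (2 * N)) fun n =>
      (hle n).2.trans (le_of_eq (by ring))⟩

/-- Solutions with the same initial value coincide. -/
theorem DriverBound.eq_of_isPicardImage_self (hD : DriverBound T α L tops X XX Z Z')
    (hF : FunBound L F F₁ F₂) (hα : 1 / 3 < α) (hL : 0 ≤ L) (hN : 0 ≤ N)
    (hT : 0 ≤ T) (hT1 : T ≤ 1) (h : CtrlBound α 0 T X N N Y Y') (ht : CtrlBound α 0 T X N N Yt Yt')
    (h0 : Y 0 = Yt 0)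
    (hQ : IsPicardImage α 0 T tops XX Z Z' F F₁ Y Y' Y Y')
    (hQt : IsPicardImage α 0 T tops XX Z Z' F F₁ Yt Yt' Yt Yt') {t : ℝ} (h1 : 0 ≤ t)
    (h2 : t ≤ T) : Y t = Yt t ∧ Y' t = Yt' t := by
  obtain ⟨δ, hδ, -, hδ'⟩ := exists_pos_mul_rpow_le_half one_pos (picardConst_nonneg hα hL hN)
    (by linarith : 0 < α)
  have h0' : Y' 0 = Yt' 0 := by rw [hQ.deriv_eq 0 le_rfl hT, hQt.deriv_eq 0 le_rfl hT, h0]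
  have key : ∀ n : ℕ, ∀ t, 0 ≤ t → t ≤ T → t ≤ n * δ → Y t = Yt t ∧ Y' t = Yt' t := fun n => by
    induction n with
    | zero =>
      intro t ht1 _ ht2
      obtain rfl : t = 0 := le_antisymm (by simpa using ht2) ht1
      exact ⟨h0, h0'⟩
    | succ n ih =>
      intro t ht1 htT ht2
      rcases le_total t (n * δ) with htn | htn
      · exact ih t ht1 htT htn
      have hn : 0 ≤ n * δ := by positivity
      push_cast at ht2
      obtain ⟨e1, e2⟩ := ih (n * δ) hn (htn.trans htT) le_rfl
      exact hD.eqOn_of_isPicardImage_self hF hα hL hN hn htT htn (by linarith)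
        (hδ' _ (by linarith) (by linarith)) (h.restrict hn htT) (ht.restrict hn htT) e1 e2
        (hQ.restrict hn htT) (hQt.restrict hn htT) htn le_rfl
  obtain ⟨n, hn⟩ := exists_nat_ge (t / δ)
  exact key n t h1 h2 ((div_le_iff₀ hδ).1 hn)

/-- A solution of the integral equation is a fixed point of the Picard map. -/
theorem DriverBound.isPicardImage_of_isRoughIntegral [CompleteSpace W]
    (hD : DriverBound T α L tops X XX Z Z') (hF : FunBound L F F₁ F₂) (hα : 1 / 3 < α)
    (hL : 0 ≤ L) (hN : 0 ≤ N) (h : CtrlBound α 0 T X N N Y Y')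
    (h' : ∀ t, 0 ≤ t → t ≤ T → Y' t = (F (Y t)).comp (Z' t))
    (hI : ∀ t, 0 ≤ t → t ≤ T → IsRoughIntegral tops XX (fun r => F (Y r))
      (fun r => (F₁ (Y r)).comp (Y' r)) Z Z' 0 t (Y t - Y 0)) :
    IsPicardImage α 0 T tops XX Z Z' F F₁ Y Y' Y Y' := by
  obtain ⟨Q, Q', hQ0, hQ⟩ := hD.exists_isPicardImage hF hα hL hN le_rfl le_rfl h (Y 0)
  obtain ⟨K, hK⟩ := hQ.germ_le
  refine hQ.congr (fun t h1 h2 => ?_) (fun t h1 h2 => (h' t h1 h2).trans (hQ.deriv_eq t h1 h2).symm)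
  have := (hI t h1 h2).unique h1 (isRoughIntegral_of_germ (by linarith) hK le_rfl h1 h2)
  rwa [hQ0, sub_left_inj] at this

theorem DriverBound.exists_ctrlBound (hD : DriverBound T α L tops X XX Z Z') (hα : 0 < α)
    (hL : 0 ≤ L) (hT : 0 ≤ T) (hT1 : T ≤ 1) (hd : 0 ≤ d) (h : CtrlSeminormLE α 0 T X d Y Y') :
    ∃ N, 0 ≤ N ∧ CtrlBound α 0 T X N N Y Y' := by
  have hη := Real.rpow_nonneg (sub_nonneg.2 hT) α
  have hb := h.ctrlBound (M := ‖Y 0‖ + ‖Y' 0‖) hα hL (by positivity) hd (by linarith) hD.path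
    (by simp) (by simp)
  have he : 0 ≤ (‖Y 0‖ + ‖Y' 0‖ + d * (T - 0) ^ α) * (1 + L) := by positivity
  exact ⟨_, add_nonneg he hd, hb.mono (by linarith) (by linarith)⟩

theorem DriverBound.restrict {S : ℝ} (h : DriverBound T α L tops X XX Z Z') (hS : S ≤ T) :
    DriverBound S α L tops X XX Z Z' where
  chen s u t hs hsu hut ht := h.chen s u t hs hsu hut (ht.trans hS)
  path s t hs hst ht := h.path s t hs hst (ht.trans hS)
  area s t hs hst ht := h.area s t hs hst (ht.trans hS)
  ctrl := h.ctrl.restrict le_rfl hS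

/-- Local existence: the Picard map has a fixed point on a short time interval. -/
theorem DriverBound.exists_isPicardImage_self [CompleteSpace W]
    (hD : DriverBound T α L tops X XX Z Z') (hF : FunBound L F F₁ F₂) (hα : 1 / 3 < α)
    (hL : 0 ≤ L) (hT : 0 < T) (hT1 : T ≤ 1) (y₀ : W) :
    ∃ τ, 0 < τ ∧ τ ≤ T ∧ ∃ Y Y' d, Y 0 = y₀ ∧ 0 ≤ d ∧ CtrlSeminormLE α 0 τ X d Y Y' ∧
      IsPicardImage α 0 τ tops XX Z Z' F F₁ Y Y' Y Y' := by
  have hα0 : 0 < α := by linarith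
  obtain ⟨m, hm⟩ : ∃ m, m = ‖y₀‖ + ‖(F y₀).comp (Z' 0)‖ := ⟨_, rfl⟩
  have hm0 : 0 ≤ m := hm ▸ by positivity
  obtain ⟨e, he⟩ : ∃ e, e = (m + 1) * (1 + L) := ⟨_, rfl⟩
  have he0 : 0 ≤ e := he ▸ by positivity
  obtain ⟨N, hN⟩ : ∃ N, N = integralConst α L * (L * (1 + e) + 1) := ⟨_, rfl⟩
  have hN0 : 0 ≤ N := by
    have := integralConst_nonneg hα hL
    rw [hN]
    positivity
  have hM0 : 0 ≤ e + N := by positivity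
  have hP := picardConst_nonneg hα hL hM0
  have hC : 0 ≤ L * (1 + 3 * (e + N) + (e + N) ^ 2) * (2 * (e + N)) := by positivity
  obtain ⟨τ, hτ, hτT, hsmall⟩ := exists_pos_mul_rpow_le_half hT (add_nonneg (add_nonneg hP hC) hN0)
    hα0
  have hη := hsmall τ hτ.le le_rfl
  have hη0 := Real.rpow_nonneg hτ.le α
  have h1 : picardConst α L (e + N) * τ ^ α ≤ 1 / 2 := by nlinarith [mul_nonneg hC hη0]
  have h2 : L * (1 + 3 * (e + N) + (e + N) ^ 2) * (2 * (e + N)) * τ ^ α ≤ 1 := by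
    nlinarith [mul_nonneg hP hη0]
  have h3 : N * τ ^ α ≤ 1 := by nlinarith [mul_nonneg hP hη0, mul_nonneg hC hη0]
  have hτ1 : τ - 0 ≤ 1 := by linarith
  have hX : ∀ s t, 0 ≤ s → s ≤ t → t ≤ τ → ‖X t - X s‖ ≤ L * (t - s) ^ α :=
    fun s t hs hst ht => hD.path s t hs hst (ht.trans hτT)
  have hbd : ∀ Y Y', CtrlSeminormLE α 0 τ X N Y Y' → Y 0 = y₀ → Y' 0 = (F y₀).comp (Z' 0) →
      CtrlBound α 0 τ X e N Y Y' := fun Y Y' h hy hy' => by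
    refine (h.ctrlBound (M := m) hα0 hL hm0 hN0 hτ1 hX ?_ ?_).mono ?_ le_rfl
    · simp [hy, hm]
    · simp [hy', hm]
    · rw [he, sub_zero]
      gcongr
  obtain ⟨p, hp, q, -, hR, hpq⟩ := exists_picard_limit (a := 0) (b := τ) (X := X) hα0 hL hN0 hτ.le
    hτ1 hX y₀ ((F y₀).comp (Z' 0))
    (S := {p | CtrlSeminormLE α 0 τ X N p.1 p.2 ∧ p.1 0 = y₀ ∧ p.2 0 = (F y₀).comp (Z' 0)})
    (R := fun p q => IsPicardImage α 0 τ tops XX Z Z' F F₁ p.1 p.2 q.1 q.2) (fun _ => Iff.rfl)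
    (fun p hp => by
      have hb := hbd _ _ hp.1 hp.2.1 hp.2.2
      obtain ⟨Q, Q', hQ0, hQ⟩ := hD.exists_isPicardImage hF hα hL hM0 le_rfl hτT
        (hb.mono (by linarith) (by linarith) : CtrlBound α 0 τ X (e + N) (e + N) p.1 p.2) y₀
      refine ⟨(Q, Q'), ⟨?_, hQ0, ?_⟩, hQ⟩
      · rw [hN]
        exact hD.ctrlSeminormLE_picard hF hα hL hM0 le_rfl hτT hτ1 hb he0 (by linarith)
          (by linarith) (by rwa [sub_zero]) hQ
      · rw [← hp.2.1]
        exact hQ.deriv_eq 0 le_rfl hτ.le)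
    (fun p hp pt hpt q qt hR hRt d hd hs => by
      refine (hD.ctrlSeminormLE_picard_sub hF hα hL hM0 hd le_rfl hτT hτ.le hτ1
        ((hbd _ _ hp.1 hp.2.1 hp.2.2).mono (by linarith) (by linarith))
        ((hbd _ _ hpt.1 hpt.2.1 hpt.2.2).mono (by linarith) (by linarith))
        (hp.2.1.trans hpt.2.1.symm) (hp.2.2.trans hpt.2.2.symm) hs hR hRt).mono ?_
      rw [sub_zero]
      nlinarith)
  exact ⟨τ, hτ, hτT, p.1, p.2, N, hp.2.1, hN0, hp.1,
    hR.congr (fun t h1 h2 => (hpq t h1 h2).1) (fun t h1 h2 => (hpq t h1 h2).2)⟩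

end RoughEquation

/-- local existence and uniqueness for the rough differential
equation `dY = F(Y) dZ` driven by a controlled rough path `𝐙`. -/
theorem stmt14
    {V V2 W U : Type*} [NormedAddCommGroup V] [NormedSpace ℝ V] [CompleteSpace V]
    [NormedAddCommGroup V2] [NormedSpace ℝ V2] [CompleteSpace V2]
    [NormedAddCommGroup W] [NormedSpace ℝ W] [CompleteSpace W]
    [NormedAddCommGroup U] [NormedSpace ℝ U] [CompleteSpace U]
    (T α : ℝ) (hT : 0 < T) (hα : 1 / 3 < α) (hα' : α ≤ 1 / 2)
    (tops : TensorOps V V2 U W) (X : ℝ → V) (XX : ℝ → ℝ → V2)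
    (hX : IsRoughPath T α tops.tmul X XX)
    (Z : ℝ → U) (Z' : ℝ → V →L[ℝ] U) (hZ : IsCRP T α X Z Z')
    (F : W → U →L[ℝ] W) (hF : IsCb 3 F) (y₀ : W) :
    ∃ τ : ℝ, 0 < τ ∧ τ ≤ T ∧
      ∃ (Y : ℝ → W) (Y' : ℝ → V →L[ℝ] W),
        (IsCRP τ α X Y Y' ∧ Y 0 = y₀ ∧
          (∀ t : ℝ, 0 ≤ t → t ≤ τ → Y' t = (F (Y t)).comp (Z' t)) ∧
          (∀ t : ℝ, 0 ≤ t → t ≤ τ →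
            IsRoughIntegral tops XX (fun r => F (Y r))
              (fun r => (fderiv ℝ F (Y r)).comp (Y' r)) Z Z' 0 t (Y t - y₀))) ∧
        ∀ (Yt : ℝ → W) (Yt' : ℝ → V →L[ℝ] W),
          IsCRP τ α X Yt Yt' → Yt 0 = y₀ →
          (∀ t : ℝ, 0 ≤ t → t ≤ τ → Yt' t = (F (Yt t)).comp (Z' t)) →
          (∀ t : ℝ, 0 ≤ t → t ≤ τ →
            IsRoughIntegral tops XX (fun r => F (Yt r))
              (fun r => (fderiv ℝ F (Yt r)).comp (Yt' r)) Z Z' 0 t (Yt t - y₀)) →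
          ∀ t : ℝ, 0 ≤ t → t ≤ τ → Yt t = Y t ∧ Yt' t = Y' t := by
  have hα0 : 0 < α := by linarith
  have hS0 : 0 < min T 1 := lt_min hT one_pos
  obtain ⟨L₁, hL₁, hD⟩ := exists_driverBound hα0 hX hZ (min_le_left T 1) (min_le_right T 1) hS0.le
  obtain ⟨L₂, hL₂, hFb⟩ := hF.exists_funBound
  have hL := add_nonneg hL₁ hL₂
  replace hD := hD.mono (le_add_of_nonneg_right hL₂ : L₁ ≤ L₁ + L₂)
  replace hFb := hFb.mono (le_add_of_nonneg_left hL₁ : L₂ ≤ L₁ + L₂)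
  obtain ⟨τ, hτ, hτS, Y, Y', d, hY0, hd, hYd, hY⟩ :=
    hD.exists_isPicardImage_self hFb hα hL hS0 (min_le_right T 1) y₀
  have hτ1 : τ ≤ 1 := hτS.trans (min_le_right T 1)
  replace hD := hD.restrict hτS
  refine ⟨τ, hτ, hτS.trans (min_le_left T 1), Y, Y',
    ⟨hYd.isCRP, hY0, hY.deriv_eq, fun t h1 h2 => ?_⟩, fun Yt Yt' hYt hYt0 hYt' hI t h1 h2 => ?_⟩
  · obtain ⟨K, hK⟩ := hY.germ_le
    rw [← hY0]
    exact isRoughIntegral_of_germ (by linarith) hK le_rfl h1 h2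
  · obtain ⟨dt, hdt, hYtd⟩ := hYt.exists_ctrlSeminormLE
    obtain ⟨N, hN, hYN⟩ := hD.exists_ctrlBound hα0 hL hτ.le hτ1 hd hYd
    obtain ⟨Nt, hNt, hYtN⟩ := hD.exists_ctrlBound hα0 hL hτ.le hτ1 hdt hYtd
    subst hYt0
    have hYtI := hD.isPicardImage_of_isRoughIntegral hFb hα hL hNt hYtN hYt' hI
    exact hD.eq_of_isPicardImage_self hFb hα hL (add_nonneg hN hNt) hτ.le hτ1
      (hYtN.mono (by linarith) (by linarith)) (hYN.mono (by linarith) (by linarith)) hY0.symm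
      hYtI hY h1 h2
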